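/- Local well-posedness of the Boltzmann hierarchy with velocity weights (Theorem 11.3). Let d ≥ 2 and ℓ > 0. Suppose F_∞(0) = {f_∞^{(s)}(0)}_{s∈ℕ} is a sequence of continuous functions f_∞^{(s)}(0) : ℝ^{2ds} → ℝ, each symmetric under particle interchange, such that for some β_0 > 0 and μ_0 ∈ ℝ: sup_{s∈ℕ} sup_{Z_s} |f_∞^{(s)}(0,Z_s)| e^{β_0 E_s(Z_s)} e^{μ_0 s} ≤ 1. Then there is a constant C_d > 0, depending only on d, such that if T_L < C_d ℓ e^{μ_0} β_0^{(d+1)/2}, there exists a unique sequence F_∞(t) = {f_∞^{(s)}(t)}_{s∈ℕ} of continuous symmetric functions f_∞^{(s)} : [0,T_L] × ℝ^{2ds} → ℝ attaining the given data at t = 0, satisfying sup_{0≤t≤T_L} sup_{s∈ℕ} sup_{Z_s} |f_∞^{(s)}(t,Z_s)| e^{(1/2)β_0 E_s(Z_s)} e^{(μ_0−1)s} ≤ 2, and solving, for each s, (∂_t + V_s·∇_{X_s}) f_∞^{(s)}(t,Z_s) = ℓ^{−1} (C⁰_{s+1} f_∞^{(s+1)})(t,Z_s) in the sense of distributions for 0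 ≤ t ≤ T_L. -/

import Mathlib

noncomputable section
open MeasureTheory Real
open scoped InnerProductSpace BigOperators

/-- Euclidean space `ℝ^d`. -/
abbrev Rd (d : ℕ) := EuclideanSpace ℝ (Fin d)

/-- The `s`-particle phase space `(ℝ^d × ℝ^d)^s`. -/
abbrev Phase (d s : ℕ) := Fin s → Rd d × Rd d

/-- The kinetic energy `E_s(Z_s) = (1/2)∑ |v_i|²`. -/
def energy {d s : ℕ} (Z : Phase d s) : ℝ := (1 / 2) * ∑ i, ‖(Z i).2‖ ^ 2

/-- The moment of inertia `I_s(Z_s) = (1/2)∑ |x_i|²`. -/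
def inertia {d s : ℕ} (Z : Phase d s) : ℝ := (1 / 2) * ∑ i, ‖(Z i).1‖ ^ 2

/-- `I_s((X_s − V_s t, V_s)) = (1/2)∑ |x_i − t v_i|²`. -/
def inertiaShift {d s : ℕ} (t : ℝ) (Z : Phase d s) : ℝ :=
  (1 / 2) * ∑ i, ‖(Z i).1 - t • (Z i).2‖ ^ 2

/-- The transport derivative `(∂_t + V_s·∇_{X_s}) φ` of a test function. -/
def transportD {d s : ℕ} (φ : ℝ → Phase d s → ℝ) (t : ℝ) (Z : Phase d s) : ℝ :=
  deriv (fun h : ℝ => φ (t + h) (fun i => ((Z i).1 + h • (Z i).2, (Z i).2))) 0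

/-- The surface measure on the unit sphere of `ℝ^d`. -/
def sphMeas (d : ℕ) : Measure (Metric.sphere (0 : Rd d) 1) :=
  (volume : Measure (Rd d)).toSphere

/-- The Boltzmann hierarchy collision operator `C⁰_{s+1}` acting on a function of
`s+1` particles, evaluated at an `s`-particle configuration. -/
def BoltzCollOp (d s : ℕ) (g : Phase d (s + 1) → ℝ) (Z : Phase d s) : ℝ :=
  ∑ i : Fin s,
    ∫ w : Rd d,
      ∫ ω : Metric.sphere (0 : Rd d) 1,
        (max ⟪(ω : Rd d), w - (Z i).2⟫_ℝ 0 *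
            g (Fin.snoc
                (Function.update Z i
                  ((Z i).1, (Z i).2 + ⟪(ω : Rd d), w - (Z i).2⟫_ℝ • (ω : Rd d)))
                ((Z i).1, w - ⟪(ω : Rd d), w - (Z i).2⟫_ℝ • (ω : Rd d)))
          - max (-⟪(ω : Rd d), w - (Z i).2⟫_ℝ) 0 *
              g (Fin.snoc Z ((Z i).1, w))) ∂(sphMeas d)

/-- The family `f` solves the Boltzmann hierarchy
`(∂_t + V_s·∇_{X_s}) f^{(s)} = ℓ⁻¹ C⁰_{s+1} f^{(s+1)}` in the sense of distributions
on `S × ℝ^{2ds}`, `S` being an open set of times. -/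
def SolvesBoltzmannHierarchy (d : ℕ) (ℓ : ℝ) (S : Set ℝ)
    (f : (s : ℕ) → ℝ → Phase d s → ℝ) : Prop :=
  ∀ s : ℕ, 1 ≤ s → ∀ φ : ℝ → Phase d s → ℝ,
    ContDiff ℝ 1 (Function.uncurry φ) →
    HasCompactSupport (Function.uncurry φ) →
    (∀ t : ℝ, t ∉ S → ∀ Z, φ t Z = 0) →
    (∫ t in S, ∫ Z : Phase d s,
      (transportD φ t Z * f s t Z
        + ℓ⁻¹ * φ t Z * BoltzCollOp d s (f (s + 1) t) Z)) = 0

/-- The properties required of the local solution in Theorem 11.3: continuity on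
`[0,T_L]`, symmetry, attainment of the initial data, the weighted bound with the
velocity (energy) weight, and the Boltzmann hierarchy in distributions on `(0,T_L)`. -/
def GoodLocalSolE (d : ℕ) (ℓ T β₀ μ₀ : ℝ) (f₀ : (s : ℕ) → Phase d s → ℝ)
    (f : (s : ℕ) → ℝ → Phase d s → ℝ) : Prop :=
  (∀ s : ℕ, ContinuousOn (Function.uncurry (f s))
      (Set.Icc (0 : ℝ) T ×ˢ (Set.univ : Set (Phase d s)))) ∧
  (∀ s : ℕ, ∀ σ : Equiv.Perm (Fin s), ∀ t : ℝ, ∀ Z : Phase d s,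
      f s t (Z ∘ σ) = f s t Z) ∧
  (∀ s : ℕ, ∀ Z : Phase d s, f s 0 Z = f₀ s Z) ∧
  (∀ t ∈ Set.Icc (0 : ℝ) T, ∀ s : ℕ, 1 ≤ s → ∀ Z : Phase d s,
      |f s t Z| * exp ((1 / 2) * β₀ * energy Z) * exp ((μ₀ - 1) * s) ≤ 2) ∧
  SolvesBoltzmannHierarchy d ℓ (Set.Ioo (0 : ℝ) T) f

/-! ### Pointwise facts about the collision operator -/

/-- The integrand of the `i`-th summand of the collision operator. -/
def collIntegrand {d s : ℕ} (g : Phase d (s + 1) → ℝ) (Z : Phase d s) (i : Fin s) (w : Rd d)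
    (ω : Metric.sphere (0 : Rd d) 1) : ℝ :=
  max ⟪(ω : Rd d), w - (Z i).2⟫_ℝ 0 *
      g (Fin.snoc
          (Function.update Z i
            ((Z i).1, (Z i).2 + ⟪(ω : Rd d), w - (Z i).2⟫_ℝ • (ω : Rd d)))
          ((Z i).1, w - ⟪(ω : Rd d), w - (Z i).2⟫_ℝ • (ω : Rd d)))
    - max (-⟪(ω : Rd d), w - (Z i).2⟫_ℝ) 0 * g (Fin.snoc Z ((Z i).1, w))

lemma boltzCollOp_eq_sum {d s : ℕ} (g : Phase d (s + 1) → ℝ) (Z : Phase d s) :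
    BoltzCollOp d s g Z
      = ∑ i : Fin s, ∫ w : Rd d, ∫ ω, collIntegrand g Z i w ω ∂(sphMeas d) := rfl

instance isFiniteMeasure_sphMeas (d : ℕ) : IsFiniteMeasure (sphMeas d) := by
  unfold sphMeas; infer_instance

lemma energy_nonneg {d s : ℕ} (Z : Phase d s) : 0 ≤ energy Z := by
  unfold energy; positivity

lemma energy_snoc {d s : ℕ} (Z : Phase d s) (a : Rd d × Rd d) :
    energy (Fin.snoc Z a : Phase d (s + 1)) = energy Z + ‖a.2‖ ^ 2 / 2 := by
  unfold energy
  rw [Fin.sum_univ_castSucc]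
  simp only [Fin.snoc_castSucc, Fin.snoc_last]
  ring

lemma energy_update {d s : ℕ} (Z : Phase d s) (i : Fin s) (a : Rd d × Rd d) :
    energy (Function.update Z i a) = energy Z + (‖a.2‖ ^ 2 - ‖(Z i).2‖ ^ 2) / 2 := by
  unfold energy
  rw [← Finset.add_sum_erase _ _ (Finset.mem_univ i),
    ← Finset.add_sum_erase _ (fun j => ‖(Z j).2‖ ^ 2) (Finset.mem_univ i)]
  have h : ∑ j ∈ Finset.univ.erase i, ‖(Function.update Z i a j).2‖ ^ 2
      = ∑ j ∈ Finset.univ.erase i, ‖(Z j).2‖ ^ 2 :=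
    Finset.sum_congr rfl fun j hj => by
      rw [Function.update_of_ne (Finset.ne_of_mem_erase hj)]
  rw [h, Function.update_self]
  ring

/-- Elastic collisions conserve kinetic energy. -/
lemma norm_sq_collision {d : ℕ} (v w : Rd d) (ω : Metric.sphere (0 : Rd d) 1) :
    ‖v + ⟪(ω : Rd d), w - v⟫_ℝ • (ω : Rd d)‖ ^ 2 + ‖w - ⟪(ω : Rd d), w - v⟫_ℝ • (ω : Rd d)‖ ^ 2
      = ‖v‖ ^ 2 + ‖w‖ ^ 2 := by
  have hω : ‖(ω : Rd d)‖ = 1 := by simp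
  have ha : ⟪(ω : Rd d), w - v⟫_ℝ = ⟪w, (ω : Rd d)⟫_ℝ - ⟪v, (ω : Rd d)⟫_ℝ := by
    rw [real_inner_comm, inner_sub_left]
  rw [norm_add_sq_real, norm_sub_sq_real, inner_smul_right, inner_smul_right, norm_smul, hω,
    mul_one, Real.norm_eq_abs, sq_abs, ha]
  ring

lemma energy_collision {d s : ℕ} (Z : Phase d s) (i : Fin s) (w : Rd d)
    (ω : Metric.sphere (0 : Rd d) 1) :
    energy (Fin.snoc
        (Function.update Z i ((Z i).1, (Z i).2 + ⟪(ω : Rd d), w - (Z i).2⟫_ℝ • (ω : Rd d)))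
        ((Z i).1, w - ⟪(ω : Rd d), w - (Z i).2⟫_ℝ • (ω : Rd d)) : Phase d (s + 1))
      = energy Z + ‖w‖ ^ 2 / 2 := by
  rw [energy_snoc, energy_update]
  have := norm_sq_collision (Z i).2 w ω
  simp only
  linarith

lemma abs_posPart_mul_sub_le {a p q P : ℝ} (hp : |p| ≤ P) (hq : |q| ≤ P) :
    |max a 0 * p - max (-a) 0 * q| ≤ |a| * P := by
  rcases le_total 0 a with h | h
  · rw [max_eq_left h, max_eq_right (by linarith), zero_mul, sub_zero, abs_mul]
    gcongr
  · rw [max_eq_right h, max_eq_left (by linarith), zero_mul, zero_sub, abs_neg, abs_mul, abs_neg]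
    gcongr

lemma abs_collIntegrand_le {d s : ℕ} {g : Phase d (s + 1) → ℝ} {N b : ℝ}
    (hg : ∀ Y, |g Y| ≤ N * exp (-(b * energy Y))) (Z : Phase d s) (i : Fin s) (w : Rd d)
    (ω : Metric.sphere (0 : Rd d) 1) :
    |collIntegrand g Z i w ω|
      ≤ ‖w - (Z i).2‖ * (N * exp (-(b * (energy Z + ‖w‖ ^ 2 / 2)))) := by
  have h1 := hg (Fin.snoc
        (Function.update Z i ((Z i).1, (Z i).2 + ⟪(ω : Rd d), w - (Z i).2⟫_ℝ • (ω : Rd d)))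
        ((Z i).1, w - ⟪(ω : Rd d), w - (Z i).2⟫_ℝ • (ω : Rd d)))
  have h2 := hg (Fin.snoc Z ((Z i).1, w))
  rw [energy_collision] at h1
  rw [energy_snoc] at h2
  refine (abs_posPart_mul_sub_le h1 h2).trans ?_
  have hω : ‖(ω : Rd d)‖ = 1 := by simp
  have h3 := abs_real_inner_le_norm (ω : Rd d) (w - (Z i).2)
  rw [hω, one_mul] at h3
  exact mul_le_mul_of_nonneg_right h3 ((abs_nonneg _).trans h1)

lemma mul_gaussian_le {d : ℕ} {b B : ℝ} (hB : 0 < B) (hb : B ≤ b) (v w : Rd d) :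
    ‖w - v‖ * exp (-(b * (‖w‖ ^ 2 / 2)))
      ≤ (1 / √B + ‖v‖) * exp (-(B / 4) * ‖w‖ ^ 2) := by
  have hsB : 0 < √B := Real.sqrt_pos.2 hB
  have h1 : ‖w‖ ≤ 1 / √B * exp (B / 4 * ‖w‖ ^ 2) := by
    have h2 := Real.add_one_le_exp (B / 4 * ‖w‖ ^ 2)
    have h3 : √B * ‖w‖ ≤ B / 4 * ‖w‖ ^ 2 + 1 := by
      nlinarith [sq_nonneg (√B * ‖w‖ - 2), Real.sq_sqrt hB.le]
    rw [one_div, inv_mul_eq_div, le_div_iff₀ hsB]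
    linarith
  have h4 : 1 ≤ exp (B / 4 * ‖w‖ ^ 2) := Real.one_le_exp (by positivity)
  have h5 : ‖w - v‖ ≤ (1 / √B + ‖v‖) * exp (B / 4 * ‖w‖ ^ 2) := by
    have := norm_sub_le w v
    nlinarith [mul_le_mul_of_nonneg_left h4 (norm_nonneg v)]
  calc ‖w - v‖ * exp (-(b * (‖w‖ ^ 2 / 2)))
      ≤ ((1 / √B + ‖v‖) * exp (B / 4 * ‖w‖ ^ 2)) * exp (-(B * (‖w‖ ^ 2 / 2))) := by
        gcongr
    _ = (1 / √B + ‖v‖) * exp (-(B / 4) * ‖w‖ ^ 2) := by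
        rw [mul_assoc, ← Real.exp_add]
        congr 2
        ring

lemma abs_collIntegrand_le_gaussian {d s : ℕ} {g : Phase d (s + 1) → ℝ} {N b B : ℝ}
    (hB : 0 < B) (hb : B ≤ b) (hg : ∀ Y, |g Y| ≤ N * exp (-(b * energy Y)))
    (Z : Phase d s) (i : Fin s) (w : Rd d) (ω : Metric.sphere (0 : Rd d) 1) :
    |collIntegrand g Z i w ω|
      ≤ N * exp (-(b * energy Z)) * (1 / √B + ‖(Z i).2‖) * exp (-(B / 4) * ‖w‖ ^ 2) := by
  have hN : 0 ≤ N :=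
    nonneg_of_mul_nonneg_left ((abs_nonneg _).trans (hg (fun _ => 0))) (exp_pos _)
  refine (abs_collIntegrand_le hg Z i w ω).trans ?_
  have := mul_le_mul_of_nonneg_left (mul_gaussian_le hB hb (Z i).2 w)
    (mul_nonneg hN (exp_pos (-(b * energy Z))).le)
  refine le_trans (le_of_eq ?_) (this.trans (le_of_eq ?_))
  · rw [mul_add, neg_add, Real.exp_add]
    ring
  · ring

lemma integral_gaussian_pos {d : ℕ} {B : ℝ} (hB : 0 < B) :
    ∫ w : Rd d, exp (-(B / 4) * ‖w‖ ^ 2) = (4 * π / B) ^ ((d : ℝ) / 2) := by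
  rw [GaussianFourier.integral_rexp_neg_mul_sq_norm (by positivity)]
  simp only [finrank_euclideanSpace, Fintype.card_fin]
  congr 1
  field_simp

lemma integrable_gaussian_norm {d : ℕ} {B : ℝ} (hB : 0 < B) :
    Integrable fun w : Rd d => exp (-(B / 4) * ‖w‖ ^ 2) := by
  refine not_imp_comm.1 integral_undef ?_
  rw [integral_gaussian_pos hB]
  have := Real.pi_pos
  positivity

lemma abs_boltzCollOp_le {d s : ℕ} {g : Phase d (s + 1) → ℝ} {N b B : ℝ}
    (hB : 0 < B) (hb : B ≤ b) (hg : ∀ Y, |g Y| ≤ N * exp (-(b * energy Y)))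
    (Z : Phase d s) :
    |BoltzCollOp d s g Z|
      ≤ N * exp (-(b * energy Z)) * ((sphMeas d).real Set.univ * (4 * π / B) ^ ((d : ℝ) / 2)) *
          ∑ i, (1 / √B + ‖(Z i).2‖) := by
  rw [boltzCollOp_eq_sum, Finset.mul_sum]
  refine (Finset.abs_sum_le_sum_abs _ _).trans (Finset.sum_le_sum fun i _ => ?_)
  have h1 : ∀ w : Rd d, ‖∫ ω, collIntegrand g Z i w ω ∂(sphMeas d)‖
      ≤ N * exp (-(b * energy Z)) * (1 / √B + ‖(Z i).2‖) * (sphMeas d).real Set.univ *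
        exp (-(B / 4) * ‖w‖ ^ 2) := fun w =>
    (norm_integral_le_of_norm_le_const (.of_forall fun ω =>
      abs_collIntegrand_le_gaussian hB hb hg Z i w ω)).trans (le_of_eq (by ring))
  have h2 := norm_integral_le_of_norm_le ((integrable_gaussian_norm hB).const_mul _)
    (.of_forall h1)
  rw [integral_const_mul, integral_gaussian_pos hB] at h2
  exact h2.trans (le_of_eq (by ring))

/-! ### Continuity, linearity and symmetry of the collision operator -/

lemma continuous_collIntegrand {d s : ℕ} {g : ℝ → Phase d (s + 1) → ℝ}
    (hg : Continuous (Function.uncurry g)) (i : Fin s) :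
    Continuous fun p : ((ℝ × Phase d s) × Rd d) × Metric.sphere (0 : Rd d) 1 =>
      collIntegrand (g p.1.1.1) p.1.1.2 i p.1.2 p.2 := by
  have hg' : ∀ {F : ((ℝ × Phase d s) × Rd d) × Metric.sphere (0 : Rd d) 1 → Phase d (s + 1)},
      Continuous F → Continuous fun p => g p.1.1.1 (F p) := fun hF =>
    hg.comp ((continuous_fst.comp (continuous_fst.comp continuous_fst)).prodMk hF)
  have hZ : Continuous fun p : ((ℝ × Phase d s) × Rd d) × Metric.sphere (0 : Rd d) 1 =>
      p.1.1.2 := by fun_prop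
  unfold collIntegrand
  refine (Continuous.mul (by fun_prop) (hg' ?_)).sub (Continuous.mul (by fun_prop) (hg' ?_))
  · exact Continuous.finSnoc (hZ.update i (by fun_prop)) (by fun_prop)
  · exact Continuous.finSnoc hZ (by fun_prop)

lemma continuous_integral_collIntegrand {d s : ℕ} {g : ℝ → Phase d (s + 1) → ℝ}
    (hg : Continuous (Function.uncurry g)) (i : Fin s) :
    Continuous fun p : (ℝ × Phase d s) × Rd d =>
      ∫ ω, collIntegrand (g p.1.1) p.1.2 i p.2 ω ∂(sphMeas d) := by
  have h := continuous_parametric_integral_of_continuous (μ := sphMeas d)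
    (f := fun (p : (ℝ × Phase d s) × Rd d) ω => collIntegrand (g p.1.1) p.1.2 i p.2 ω)
    (continuous_collIntegrand hg i) isCompact_univ
  simpa only [Measure.restrict_univ] using h

lemma continuous_boltzCollOp {d s : ℕ} {g : ℝ → Phase d (s + 1) → ℝ} {N B : ℝ} (hB : 0 < B)
    (hg : Continuous (Function.uncurry g))
    (hbd : ∀ t Y, |g t Y| ≤ N * exp (-(B * energy Y))) :
    Continuous fun p : ℝ × Phase d s => BoltzCollOp d s (g p.1) p.2 := by
  have hN : 0 ≤ N :=
    nonneg_of_mul_nonneg_left ((abs_nonneg _).trans (hbd 0 (fun _ => 0))) (exp_pos _)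
  simp only [boltzCollOp_eq_sum]
  refine continuous_finsetSum _ fun i _ => ?_
  have hc := continuous_integral_collIntegrand hg i
  refine continuous_iff_continuousAt.2 fun p₀ => ?_
  refine continuousAt_of_dominated (bound := fun w : Rd d =>
      N * (1 / √B + (‖(p₀.2 i).2‖ + 1)) * (sphMeas d).real Set.univ * exp (-(B / 4) * ‖w‖ ^ 2))
    (.of_forall fun p => ?_) ?_ ((integrable_gaussian_norm hB).const_mul _)
    (.of_forall fun w => ?_)
  · exact (hc.comp (continuous_const.prodMk continuous_id)).aestronglyMeasurable
  · have hnear : ∀ᶠ p : ℝ × Phase d s in nhds p₀, ‖(p.2 i).2‖ < ‖(p₀.2 i).2‖ + 1 :=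
      (show Continuous fun p : ℝ × Phase d s => ‖(p.2 i).2‖ by fun_prop).continuousAt.eventually_lt
        continuousAt_const (lt_add_one _)
    filter_upwards [hnear] with p hp
    refine .of_forall fun w => (norm_integral_le_of_norm_le_const (.of_forall fun ω =>
      (abs_collIntegrand_le_gaussian hB le_rfl (hbd p.1) p.2 i w ω).trans ?_)).trans
        (le_of_eq (mul_right_comm _ _ _))
    have hexp : exp (-(B * energy p.2)) ≤ 1 :=
      Real.exp_le_one_iff.2 (neg_nonpos.2 (mul_nonneg hB.le (energy_nonneg _)))
    gcongr
    exact mul_le_of_le_one_right hN hexp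
  · exact (hc.comp (continuous_id.prodMk continuous_const)).continuousAt

lemma integrable_collIntegrand {d s : ℕ} {g : Phase d (s + 1) → ℝ} (hg : Continuous g)
    (Z : Phase d s) (i : Fin s) (w : Rd d) :
    Integrable (fun ω => collIntegrand g Z i w ω) (sphMeas d) := by
  have hg' : Continuous (Function.uncurry fun _ : ℝ => g) := hg.comp continuous_snd
  have hp : Continuous fun ω : Metric.sphere (0 : Rd d) 1 =>
      ((((0 : ℝ), Z), w), ω) := by fun_prop
  have h := (continuous_collIntegrand hg' i).comp hp
  simp only [Function.comp_def] at h
  exact h.integrable_of_hasCompactSupport (HasCompactSupport.of_compactSpace _)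

lemma integrable_integral_collIntegrand {d s : ℕ} {g : Phase d (s + 1) → ℝ} {N B : ℝ}
    (hB : 0 < B) (hg : Continuous g) (hbd : ∀ Y, |g Y| ≤ N * exp (-(B * energy Y)))
    (Z : Phase d s) (i : Fin s) :
    Integrable fun w : Rd d => ∫ ω, collIntegrand g Z i w ω ∂(sphMeas d) := by
  have hg' : Continuous (Function.uncurry fun _ : ℝ => g) := hg.comp continuous_snd
  have hp : Continuous fun w : Rd d => (((0 : ℝ), Z), w) := by fun_prop
  have h := (continuous_integral_collIntegrand hg' i).comp hp
  simp only [Function.comp_def] at h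
  exact ((integrable_gaussian_norm hB).const_mul _).mono' h.aestronglyMeasurable
    (.of_forall fun w => (norm_integral_le_of_norm_le_const (.of_forall fun ω =>
      abs_collIntegrand_le_gaussian hB le_rfl hbd Z i w ω)).trans
      (le_of_eq (mul_right_comm _ _ _)))

lemma boltzCollOp_sub {d s : ℕ} {g h : Phase d (s + 1) → ℝ} {N N' B : ℝ} (hB : 0 < B)
    (hg : Continuous g) (hh : Continuous h)
    (hgb : ∀ Y, |g Y| ≤ N * exp (-(B * energy Y)))
    (hhb : ∀ Y, |h Y| ≤ N' * exp (-(B * energy Y))) (Z : Phase d s) :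
    BoltzCollOp d s (fun Y => g Y - h Y) Z = BoltzCollOp d s g Z - BoltzCollOp d s h Z := by
  simp only [boltzCollOp_eq_sum]
  rw [← Finset.sum_sub_distrib]
  refine Finset.sum_congr rfl fun i _ => ?_
  rw [← integral_sub (integrable_integral_collIntegrand hB hg hgb Z i)
    (integrable_integral_collIntegrand hB hh hhb Z i)]
  refine integral_congr_ae (.of_forall fun w => ?_)
  simp only
  rw [← integral_sub (integrable_collIntegrand hg Z i w) (integrable_collIntegrand hh Z i w)]
  refine integral_congr_ae (.of_forall fun ω => ?_)
  simp only [collIntegrand]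
  ring

/-- The permutation of `s + 1` particles which permutes the first `s` by `σ`. -/
def extendPerm {s : ℕ} (σ : Equiv.Perm (Fin s)) : Equiv.Perm (Fin (s + 1)) :=
  finSuccEquivLast.symm.permCongr (Equiv.optionCongr σ)

lemma snoc_comp_perm {d s : ℕ} (Z : Phase d s) (a : Rd d × Rd d) (σ : Equiv.Perm (Fin s)) :
    (Fin.snoc (Z ∘ σ) a : Phase d (s + 1)) = (Fin.snoc Z a : Phase d (s + 1)) ∘ extendPerm σ := by
  funext j
  refine Fin.lastCases ?_ (fun j => ?_) j
  · simp [extendPerm, Equiv.permCongr_apply]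
  · simp [extendPerm, Equiv.permCongr_apply]

lemma boltzCollOp_comp_perm {d s : ℕ} {g : Phase d (s + 1) → ℝ}
    (hg : ∀ (σ : Equiv.Perm (Fin (s + 1))) Y, g (Y ∘ σ) = g Y) (σ : Equiv.Perm (Fin s))
    (Z : Phase d s) : BoltzCollOp d s g (Z ∘ σ) = BoltzCollOp d s g Z := by
  have hsnoc : ∀ (Y : Phase d s) a, g (Fin.snoc (Y ∘ σ) a) = g (Fin.snoc Y a) := fun Y a => by
    rw [snoc_comp_perm, hg]
  have hupd : ∀ i a, Function.update (Z ∘ σ) i a = Function.update Z (σ i) a ∘ σ := fun i a => by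
    rw [Function.update_comp_eq_of_injective _ σ.injective]
  rw [boltzCollOp_eq_sum, boltzCollOp_eq_sum,
    ← Equiv.sum_comp σ fun i => ∫ w : Rd d, ∫ ω, collIntegrand g Z i w ω ∂(sphMeas d)]
  refine Finset.sum_congr rfl fun i _ => ?_
  simp only [collIntegrand, hupd, hsnoc, Function.comp_apply]

/-! ### Free transport -/

instance sigmaFinite_volume_particle (d : ℕ) :
    SigmaFinite (volume : Measure (Rd d × Rd d)) :=
  inferInstanceAs (SigmaFinite ((volume : Measure (Rd d)).prod volume))

instance sigmaFinite_volume_phase (d s : ℕ) :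
    SigmaFinite (volume : Measure (Phase d s)) :=
  Measure.pi.sigmaFinite fun _ : Fin s => (volume : Measure (Rd d × Rd d))

instance isAddHaar_volume_particle (d : ℕ) :
    Measure.IsAddHaarMeasure (volume : Measure (Rd d × Rd d)) :=
  inferInstanceAs (Measure.IsAddHaarMeasure ((volume : Measure (Rd d)).prod volume))

instance isAddHaar_volume_phase (d s : ℕ) :
    Measure.IsAddHaarMeasure (volume : Measure (Phase d s)) :=
  Measure.pi.isAddHaarMeasure fun _ : Fin s => (volume : Measure (Rd d × Rd d))

/-- Free transport of the particles during time `h`. -/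
def shift {d s : ℕ} (h : ℝ) (Z : Phase d s) : Phase d s :=
  fun i => ((Z i).1 + h • (Z i).2, (Z i).2)

lemma shift_shift {d s : ℕ} (h k : ℝ) (Z : Phase d s) :
    shift h (shift k Z) = shift (k + h) Z := by
  funext i
  simp only [shift, add_smul, add_assoc]

lemma shift_zero {d s : ℕ} (Z : Phase d s) : shift 0 Z = Z := by
  funext i
  simp [shift]

lemma energy_shift {d s : ℕ} (h : ℝ) (Z : Phase d s) : energy (shift h Z) = energy Z := rfl

lemma shift_comp_perm {d s : ℕ} (h : ℝ) (Z : Phase d s) (σ : Equiv.Perm (Fin s)) :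
    shift h (Z ∘ σ) = shift h Z ∘ σ := rfl

lemma contDiff_shift {d s : ℕ} :
    ContDiff ℝ 1 fun p : ℝ × Phase d s => shift p.1 p.2 := by
  unfold shift
  fun_prop

lemma continuous_shift {d s : ℕ} : Continuous fun p : ℝ × Phase d s => shift p.1 p.2 :=
  contDiff_shift.continuous

/-- Space-time straightening `(t, Y) ↦ (t, Y shifted by t)` of the characteristics. -/
def straighten (d s : ℕ) : (ℝ × Phase d s) ≃ₜ (ℝ × Phase d s) where
  toFun p := (p.1, shift p.1 p.2)
  invFun p := (p.1, shift (-p.1) p.2)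
  left_inv p := by simp [shift_shift, shift_zero]
  right_inv p := by simp [shift_shift, shift_zero]
  continuous_toFun := continuous_fst.prodMk continuous_shift
  continuous_invFun := continuous_fst.prodMk
    (continuous_shift.comp (continuous_fst.neg.prodMk continuous_snd))

/-- Free transport during time `h` as a homeomorphism of phase space. -/
def shiftHomeo (d s : ℕ) (h : ℝ) : Phase d s ≃ₜ Phase d s where
  toFun := shift h
  invFun := shift (-h)
  left_inv Z := by simp [shift_shift, shift_zero]
  right_inv Z := by simp [shift_shift, shift_zero]
  continuous_toFun := continuous_shift.comp (continuous_const.prodMk continuous_id)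
  continuous_invFun := continuous_shift.comp (continuous_const.prodMk continuous_id)

lemma measurePreserving_shift {d s : ℕ} (h : ℝ) :
    MeasurePreserving (shift h : Phase d s → Phase d s) volume volume := by
  have h1 : MeasurePreserving (fun p : Rd d × Rd d => (p.1, p.2 + h • p.1))
      (volume.prod volume) (volume.prod volume) :=
    (MeasurePreserving.id (volume : Measure (Rd d))).skew_product
      (g := fun v x => x + h • v) (by fun_prop)
      (.of_forall fun v => (measurePreserving_add_right volume (h • v)).map_eq)
  have h2 : MeasurePreserving (fun p : Rd d × Rd d => (p.1 + h • p.2, p.2))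
      (volume : Measure (Rd d × Rd d)) volume :=
    (Measure.measurePreserving_swap.comp h1).comp Measure.measurePreserving_swap
  exact volume_preserving_pi fun _ : Fin s => h2

lemma integral_shift {d s : ℕ} (h : ℝ) (F : Phase d s → ℝ) :
    ∫ Y, F (shift h Y) = ∫ Z, F Z :=
  (measurePreserving_shift h).integral_comp (shiftHomeo d s h).measurableEmbedding F

lemma hasDerivAt_along_shift {d s : ℕ} {φ : ℝ → Phase d s → ℝ}
    (hφ : ContDiff ℝ 1 (Function.uncurry φ)) (t : ℝ) (Y : Phase d s) :
    HasDerivAt (fun τ => φ τ (shift τ Y)) (transportD φ t (shift t Y)) t := by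
  have hd : ContDiff ℝ 1 fun τ => φ τ (shift τ Y) :=
    hφ.comp (contDiff_id.prodMk (contDiff_shift.comp (contDiff_id.prodMk contDiff_const)))
  have h1 : transportD φ t (shift t Y) = deriv (fun τ => φ τ (shift τ Y)) t := by
    have h2 : transportD φ t (shift t Y)
        = deriv (fun h => (fun τ => φ τ (shift τ Y)) (t + h)) 0 := by
      simp only [← shift_shift]
      rfl
    rw [h2]
    exact (deriv_comp_const_add (fun τ => φ τ (shift τ Y)) t 0).trans (by rw [add_zero])
  rw [h1]
  exact (hd.differentiable one_ne_zero t).hasDerivAt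

lemma transportD_eq_fderiv {d s : ℕ} {φ : ℝ → Phase d s → ℝ}
    (hφ : ContDiff ℝ 1 (Function.uncurry φ)) (t : ℝ) (Z : Phase d s) :
    transportD φ t Z
      = fderiv ℝ (Function.uncurry φ) (t, Z) (1, fun i => ((Z i).2, 0)) := by
  have hγ : HasDerivAt (fun h : ℝ => ((t + h, shift h Z) : ℝ × Phase d s))
      (1, fun i => ((Z i).2, 0)) 0 := by
    refine ((hasDerivAt_id (0 : ℝ)).const_add t).prodMk (hasDerivAt_pi.2 fun i => ?_)
    have h1 : HasDerivAt (fun h : ℝ => (Z i).1 + h • (Z i).2) ((1 : ℝ) • (Z i).2) 0 :=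
      ((hasDerivAt_id (0 : ℝ)).smul_const _).const_add _
    rw [one_smul] at h1
    exact h1.prodMk (hasDerivAt_const _ _)
  have h0 : ((t, Z) : ℝ × Phase d s) = (t + 0, shift 0 Z) := by rw [add_zero, shift_zero]
  have hf : HasFDerivAt (Function.uncurry φ) (fderiv ℝ (Function.uncurry φ) (t, Z))
      (t + 0, shift 0 Z) := by
    rw [← h0]
    exact (hφ.differentiable one_ne_zero _).hasFDerivAt
  exact (hf.comp_hasDerivAt (0 : ℝ) hγ).deriv

lemma continuous_transportD {d s : ℕ} {φ : ℝ → Phase d s → ℝ}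
    (hφ : ContDiff ℝ 1 (Function.uncurry φ)) :
    Continuous fun p : ℝ × Phase d s => transportD φ p.1 p.2 := by
  simp only [transportD_eq_fderiv hφ]
  exact (hφ.continuous_fderiv one_ne_zero).clm_apply (by fun_prop)

lemma hasCompactSupport_transportD {d s : ℕ} {φ : ℝ → Phase d s → ℝ}
    (hφ : ContDiff ℝ 1 (Function.uncurry φ)) (hc : HasCompactSupport (Function.uncurry φ)) :
    HasCompactSupport fun p : ℝ × Phase d s => transportD φ p.1 p.2 := by
  refine (hc.fderiv (𝕜 := ℝ)).mono fun p hp => ?_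
  rw [Function.mem_support] at hp ⊢
  contrapose! hp
  rw [transportD_eq_fderiv hφ, hp]
  rfl

/-! ### Mild and distributional solutions of a transport equation -/

/-- The solution at time `t` of the transport equation with source `c` and zero data. -/
def duhamel {d s : ℕ} (c : ℝ → Phase d s → ℝ) (t : ℝ) (Z : Phase d s) : ℝ :=
  ∫ τ in (0 : ℝ)..t, c τ (shift (τ - t) Z)

lemma continuous_duhamel {d s : ℕ} {c : ℝ → Phase d s → ℝ}
    (hc : Continuous (Function.uncurry c)) : Continuous (Function.uncurry (duhamel c)) := by
  have h : Continuous (Function.uncurry fun (p : ℝ × Phase d s) τ => c τ (shift (τ - p.1) p.2)) :=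
    hc.comp (continuous_snd.prodMk (continuous_shift.comp
      ((continuous_snd.sub (continuous_fst.comp continuous_fst)).prodMk
        (continuous_snd.comp continuous_fst))))
  exact intervalIntegral.continuous_parametric_intervalIntegral_of_continuous h continuous_fst

lemma duhamel_along_shift {d s : ℕ} (c : ℝ → Phase d s → ℝ) (t : ℝ) (Y : Phase d s) :
    duhamel c t (shift t Y) = ∫ τ in (0 : ℝ)..t, c τ (shift τ Y) := by
  simp only [duhamel, shift_shift, add_sub_cancel]

/-- Integrating a transport derivative against a mild solution. -/
lemma integral_transport_duhamel {d s : ℕ} {T : ℝ} (hT : 0 < T) {c φ : ℝ → Phase d s → ℝ}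
    {u₀ : Phase d s → ℝ} (hc : Continuous (Function.uncurry c)) (hu₀ : Continuous u₀)
    (hφ : ContDiff ℝ 1 (Function.uncurry φ)) (hφc : HasCompactSupport (Function.uncurry φ))
    (hφ0 : ∀ t : ℝ, t ∉ Set.Ioo 0 T → ∀ Z, φ t Z = 0) :
    ∫ t in Set.Ioo 0 T, ∫ Z, (transportD φ t Z * (u₀ (shift (-t) Z) + duhamel c t Z)
      + φ t Z * c t Z) = 0 := by
  have hcs : Continuous fun p : ℝ × Phase d s => c p.1 (shift p.1 p.2) :=
    hc.comp (straighten d s).continuous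
  let U : ℝ → Phase d s → ℝ := fun t Y => u₀ Y + ∫ τ in (0 : ℝ)..t, c τ (shift τ Y)
  let G : ℝ → Phase d s → ℝ := fun t Y =>
    transportD φ t (shift t Y) * U t Y + φ t (shift t Y) * c t (shift t Y)
  have hU : Continuous (Function.uncurry U) := by
    have h : Continuous (Function.uncurry fun (p : ℝ × Phase d s) τ => c τ (shift τ p.2)) :=
      hcs.comp (continuous_snd.prodMk (continuous_snd.comp continuous_fst))
    exact (hu₀.comp continuous_snd).add
      (intervalIntegral.continuous_parametric_intervalIntegral_of_continuous h continuous_fst)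
  have hφs : Continuous fun p : ℝ × Phase d s => φ p.1 (shift p.1 p.2) :=
    hφ.continuous.comp (straighten d s).continuous
  have hDs : Continuous fun p : ℝ × Phase d s => transportD φ p.1 (shift p.1 p.2) :=
    (continuous_transportD hφ).comp (straighten d s).continuous
  have hG : Continuous (Function.uncurry G) := (hDs.mul hU).add (hφs.mul hcs)
  have hGc : HasCompactSupport (Function.uncurry G) := by
    have h1 : HasCompactSupport fun p : ℝ × Phase d s => transportD φ p.1 (shift p.1 p.2) :=
      (hasCompactSupport_transportD hφ hφc).comp_homeomorph (straighten d s)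
    have h2 : HasCompactSupport fun p : ℝ × Phase d s => φ p.1 (shift p.1 p.2) :=
      hφc.comp_homeomorph (straighten d s)
    exact (h1.mul_right (f' := Function.uncurry U)).add
      (h2.mul_right (f' := fun p : ℝ × Phase d s => c p.1 (shift p.1 p.2)))
  have hswap : ∀ t : ℝ, ∫ Z, (transportD φ t Z * (u₀ (shift (-t) Z) + duhamel c t Z)
      + φ t Z * c t Z) = ∫ Y, G t Y := by
    intro t
    rw [← integral_shift t]
    refine integral_congr_ae (.of_forall fun Y => ?_)
    simp only [G, U, duhamel_along_shift, shift_shift, add_neg_cancel, shift_zero]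
  simp only [hswap]
  have hintegrable : Integrable (Function.uncurry G)
      ((volume.restrict (Set.Ioo 0 T)).prod (volume : Measure (Phase d s))) := by
    have h := (hG.integrable_of_hasCompactSupport (μ := volume.prod volume) hGc).restrict
      (s := Set.Ioo 0 T ×ˢ Set.univ)
    rwa [← Measure.prod_restrict, Measure.restrict_univ] at h
  rw [integral_integral_swap hintegrable]
  refine integral_eq_zero_of_ae (.of_forall fun Y => ?_)
  simp only [Pi.zero_apply]
  rw [← integral_Ioc_eq_integral_Ioo, ← intervalIntegral.integral_of_le hT.le]
  have hcY : Continuous fun τ => c τ (shift τ Y) :=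
    hcs.comp (continuous_id.prodMk continuous_const)
  have hderiv : ∀ t ∈ Set.uIcc 0 T, HasDerivAt (fun t => φ t (shift t Y) * U t Y) (G t Y) t :=
    fun t _ => (hasDerivAt_along_shift hφ t Y).mul
      ((intervalIntegral.integral_hasDerivAt_right (hcY.intervalIntegrable _ _)
        (hcY.stronglyMeasurableAtFilter _ _) hcY.continuousAt).const_add _)
  have hGY : Continuous fun t => G t Y := hG.comp (continuous_id.prodMk continuous_const)
  rw [intervalIntegral.integral_eq_sub_of_hasDerivAt hderiv (hGY.intervalIntegrable _ _),
    hφ0 T (by simp), hφ0 0 (by simp)]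
  simp

/-- The du Bois-Reymond lemma: a continuous function with zero weak derivative is constant. -/
lemma eq_of_integral_deriv_mul_eq_zero {T : ℝ} (hT : 0 < T) {m : ℝ → ℝ} (hm : Continuous m)
    (h : ∀ a a' : ℝ → ℝ, Continuous a' → (∀ t, HasDerivAt a (a' t) t) →
      (∀ t, t ∉ Set.Ioo 0 T → a t = 0) → ∫ t in Set.Ioo 0 T, a' t * m t = 0)
    {t : ℝ} (ht : t ∈ Set.Icc 0 T) : m t = m 0 := by
  let χ : ℝ → ℝ := fun t => max 0 (t * (T - t))
  have hχ : Continuous χ := by fun_prop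
  have hχpos : ∀ t ∈ Set.Ioo 0 T, 0 < χ t := fun t ht =>
    lt_max_of_lt_right (mul_pos ht.1 (by linarith [ht.2]))
  have hχlo : ∀ t ≤ 0, χ t = 0 := fun t ht =>
    max_eq_left (mul_nonpos_of_nonpos_of_nonneg ht (by linarith))
  have hχhi : ∀ t, T ≤ t → χ t = 0 := fun t ht =>
    max_eq_left (mul_nonpos_of_nonneg_of_nonpos (by linarith) (by linarith))
  have hI : 0 < ∫ t in (0 : ℝ)..T, χ t :=
    intervalIntegral.integral_pos hT hχ.continuousOn (fun t _ => le_max_left _ _)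
      ⟨T / 2, ⟨by linarith, by linarith⟩, hχpos _ ⟨by linarith, by linarith⟩⟩
  let c : ℝ := (∫ t in (0 : ℝ)..T, χ t * m t) / ∫ t in (0 : ℝ)..T, χ t
  let k : ℝ → ℝ := fun t => χ t * (m t - c)
  have hk : Continuous k := by fun_prop
  have hkint : ∫ t in (0 : ℝ)..T, k t = 0 := by
    have h1 : ∀ t, k t = χ t * m t - χ t * c := fun t => mul_sub _ _ _
    simp only [h1]
    rw [intervalIntegral.integral_sub ((hχ.fun_mul hm).intervalIntegrable _ _)
      ((hχ.fun_mul continuous_const).intervalIntegrable _ _), intervalIntegral.integral_mul_const]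
    simp only [c]
    rw [mul_div_cancel₀ _ hI.ne', sub_self]
  have hzero : ∀ t, t ∉ Set.Ioo 0 T → ∫ τ in (0 : ℝ)..t, k τ = 0 := by
    intro t ht
    rcases le_or_gt t 0 with h0 | h0
    · refine intervalIntegral.integral_zero_ae (.of_forall fun τ hτ => ?_)
      rw [Set.uIoc_of_ge h0] at hτ
      simp only [k, hχlo τ hτ.2, zero_mul]
    · have hTt : T ≤ t := by
        by_contra hlt
        exact ht ⟨h0, not_le.1 hlt⟩
      rw [← intervalIntegral.integral_add_adjacent_intervals
        (hk.intervalIntegrable 0 T) (hk.intervalIntegrable T t), hkint, zero_add]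
      refine intervalIntegral.integral_zero_ae (.of_forall fun τ hτ => ?_)
      rw [Set.uIoc_of_le hTt] at hτ
      simp only [k, hχhi τ hτ.1.le, zero_mul]
  have h1 := h (fun t => ∫ τ in (0 : ℝ)..t, k τ) k hk
    (fun t => intervalIntegral.integral_hasDerivAt_right (hk.intervalIntegrable _ _)
      (hk.stronglyMeasurableAtFilter _ _) hk.continuousAt) hzero
  rw [← integral_Ioc_eq_integral_Ioo, ← intervalIntegral.integral_of_le hT.le] at h1
  have h2 : ∫ t in (0 : ℝ)..T, χ t * (m t - c) ^ 2 = 0 := by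
    have h3 : ∀ t, χ t * (m t - c) ^ 2 = k t * m t - k t * c := fun t => by simp only [k]; ring
    simp only [h3]
    rw [intervalIntegral.integral_sub ((hk.fun_mul hm).intervalIntegrable _ _)
      ((hk.fun_mul continuous_const).intervalIntegrable _ _), intervalIntegral.integral_mul_const,
      h1, hkint]
    ring
  have hmc : Set.EqOn m (fun _ => c) (Set.Ioo 0 T) := by
    intro t ht
    by_contra hne
    have hpos : 0 < χ t * (m t - c) ^ 2 :=
      mul_pos (hχpos t ht) (by have := sub_ne_zero.2 hne; positivity)
    exact (intervalIntegral.integral_pos hT (f := fun t => χ t * (m t - c) ^ 2)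
      (by fun_prop) (fun t _ => mul_nonneg (le_max_left _ _) (sq_nonneg _))
      ⟨t, Set.Ioo_subset_Icc_self ht, hpos⟩).ne' h2
  have hcl := hmc.closure hm continuous_const
  rw [closure_Ioo hT.ne] at hcl
  rw [hcl ht, hcl ⟨le_rfl, hT.le⟩]

lemma eq_zero_of_integral_contDiff_mul_eq_zero {d s : ℕ} {G : Phase d s → ℝ}
    (hG : Continuous G)
    (h : ∀ b : Phase d s → ℝ, ContDiff ℝ 1 b → HasCompactSupport b → ∫ Y, b Y * G Y = 0)
    (Y : Phase d s) : G Y = 0 := by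
  have hae : ∀ᵐ Y, G Y = 0 := ae_eq_zero_of_integral_contDiff_smul_eq_zero
    hG.locallyIntegrable fun b hb hbc => h b (hb.of_le (by exact_mod_cast le_top)) hbc
  exact congrFun ((hG.ae_eq_iff_eq volume continuous_const).1 hae) Y

lemma continuous_integral_mul_of_hasCompactSupport {d s : ℕ} {b : Phase d s → ℝ}
    {H : ℝ → Phase d s → ℝ} (hb : Continuous b) (hbc : HasCompactSupport b)
    (hH : Continuous (Function.uncurry H)) : Continuous fun t => ∫ Y, b Y * H t Y := by
  have h := continuous_parametric_integral_of_continuous (μ := (volume : Measure (Phase d s)))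
    (f := fun t Y => b Y * H t Y) ((hb.comp continuous_snd).mul hH) hbc.isCompact
  refine h.congr fun t => setIntegral_eq_integral_of_forall_compl_eq_zero fun Y hY => ?_
  rw [image_eq_zero_of_notMem_tsupport hY, zero_mul]

/-- A continuous distributional solution of a transport equation is a mild solution. -/
lemma mild_of_weak {d s : ℕ} {T : ℝ} (hT : 0 < T) {u c : ℝ → Phase d s → ℝ}
    (hu : Continuous (Function.uncurry u)) (hc : Continuous (Function.uncurry c))
    (hw : ∀ φ : ℝ → Phase d s → ℝ, ContDiff ℝ 1 (Function.uncurry φ) →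
      HasCompactSupport (Function.uncurry φ) →
      (∀ t : ℝ, t ∉ Set.Ioo 0 T → ∀ Z, φ t Z = 0) →
      ∫ t in Set.Ioo 0 T, ∫ Z, (transportD φ t Z * u t Z + φ t Z * c t Z) = 0)
    {t : ℝ} (ht : t ∈ Set.Icc 0 T) (Z : Phase d s) :
    u t Z = u 0 (shift (-t) Z) + duhamel c t Z := by
  have hD := continuous_duhamel hc
  let H : ℝ → Phase d s → ℝ := fun t Y => u t (shift t Y) - duhamel c t (shift t Y)
  have hH : Continuous (Function.uncurry H) :=
    (hu.comp (straighten d s).continuous).sub (hD.comp (straighten d s).continuous)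
  have hweak : ∀ φ : ℝ → Phase d s → ℝ, ContDiff ℝ 1 (Function.uncurry φ) →
      HasCompactSupport (Function.uncurry φ) →
      (∀ t : ℝ, t ∉ Set.Ioo 0 T → ∀ Z, φ t Z = 0) →
      ∫ t in Set.Ioo 0 T, ∫ Y, transportD φ t (shift t Y) * H t Y = 0 := by
    intro φ hφ hφc hφ0
    have hintegrable : ∀ {v : ℝ → Phase d s → ℝ}, Continuous (Function.uncurry v) →
        Integrable (fun p : ℝ × Phase d s => transportD φ p.1 p.2 * v p.1 p.2 + φ p.1 p.2 * c p.1 p.2)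
          ((volume.restrict (Set.Ioo 0 T)).prod (volume : Measure (Phase d s))) := by
      intro v hv
      have hcont : Continuous fun p : ℝ × Phase d s =>
          transportD φ p.1 p.2 * v p.1 p.2 + φ p.1 p.2 * c p.1 p.2 :=
        ((continuous_transportD hφ).mul hv).add (hφ.continuous.mul hc)
      have hcs : HasCompactSupport fun p : ℝ × Phase d s =>
          transportD φ p.1 p.2 * v p.1 p.2 + φ p.1 p.2 * c p.1 p.2 :=
        ((hasCompactSupport_transportD hφ hφc).mul_right (f' := Function.uncurry v)).add
          (hφc.mul_right (f' := Function.uncurry c))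
      have h := (hcont.integrable_of_hasCompactSupport (μ := volume.prod volume) hcs).restrict
        (s := Set.Ioo 0 T ×ˢ Set.univ)
      rwa [← Measure.prod_restrict, Measure.restrict_univ] at h
    have h1 := hw φ hφ hφc hφ0
    have h2 := integral_transport_duhamel hT hc (u₀ := fun _ => 0) continuous_const hφ hφc hφ0
    simp only [zero_add] at h2
    have h3 := integral_integral_sub (hintegrable hu) (hintegrable hD)
    simp only [h1, h2, sub_zero] at h3
    refine Eq.trans ?_ h3
    refine integral_congr_ae (.of_forall fun t => ?_)
    simp only
    refine Eq.trans ?_ (integral_shift t _)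
    refine integral_congr_ae (.of_forall fun Y => ?_)
    simp only [H]
    ring
  have hconst : ∀ b : Phase d s → ℝ, ContDiff ℝ 1 b → HasCompactSupport b →
      ∫ Y, b Y * H t Y = ∫ Y, b Y * H 0 Y := by
    intro b hb hbc
    refine eq_of_integral_deriv_mul_eq_zero hT
      (continuous_integral_mul_of_hasCompactSupport hb.continuous hbc hH) ?_ ht
    intro a a' ha' haa' ha0
    have haC : ContDiff ℝ 1 a := contDiff_one_iff_deriv.2
      ⟨fun t => (haa' t).differentiableAt, (funext fun t => (haa' t).deriv : deriv a = a') ▸ ha'⟩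
    have hφ : ContDiff ℝ 1 (Function.uncurry fun (t : ℝ) (Z : Phase d s) =>
        a t * b (shift (-t) Z)) :=
      (haC.comp contDiff_fst).mul
        (hb.comp (contDiff_shift.comp (contDiff_fst.neg.prodMk contDiff_snd)))
    have hab : HasCompactSupport fun p : ℝ × Phase d s => a p.1 * b p.2 := by
      refine HasCompactSupport.intro (isCompact_Icc.prod hbc.isCompact :
        IsCompact (Set.Icc 0 T ×ˢ tsupport b)) fun p hp => ?_
      by_cases h1 : p.1 ∈ Set.Ioo 0 T
      · have h2 : p.2 ∉ tsupport b := fun h2 => hp ⟨Set.Ioo_subset_Icc_self h1, h2⟩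
        rw [image_eq_zero_of_notMem_tsupport h2, mul_zero]
      · rw [ha0 _ h1, zero_mul]
    have hφc : HasCompactSupport (Function.uncurry fun (t : ℝ) (Z : Phase d s) =>
        a t * b (shift (-t) Z)) := hab.comp_homeomorph (straighten d s).symm
    have h1 := hweak _ hφ hφc fun t ht Z => by rw [ha0 t ht, zero_mul]
    have hD' : ∀ τ Y, transportD (fun (t : ℝ) (Z : Phase d s) => a t * b (shift (-t) Z)) τ
        (shift τ Y) = a' τ * b Y := by
      intro τ Y
      refine (hasDerivAt_along_shift hφ τ Y).unique ?_
      simp only [shift_shift, add_neg_cancel, shift_zero]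
      exact (haa' τ).mul_const _
    simp only [hD', mul_assoc, integral_const_mul] at h1
    exact h1
  have hzero : ∀ Y, H t Y - H 0 Y = 0 := by
    have hslice : ∀ t, Continuous (H t) := fun t =>
      hH.comp (continuous_const.prodMk continuous_id)
    refine eq_zero_of_integral_contDiff_mul_eq_zero ((hslice t).sub (hslice 0))
      fun b hb hbc => ?_
    have hintegrable : ∀ t, Integrable fun Y => b Y * H t Y := fun t =>
      (hb.continuous.mul (hslice t)).integrable_of_hasCompactSupport hbc.mul_right
    simp only [mul_sub]
    rw [integral_sub (hintegrable t) (hintegrable 0), hconst b hb hbc, sub_self]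
  have h := hzero (shift (-t) Z)
  simp only [H, shift_shift, neg_add_cancel, shift_zero, add_zero] at h
  have h0 : duhamel c 0 (shift (-t) Z) = 0 := by simp [duhamel]
  linarith

/-! ### Time-dependent weights and the contraction estimate -/

/-- The projection of the real line onto `[0, T]`. -/
def clampTime (T t : ℝ) : ℝ := max 0 (min t T)

lemma continuous_clampTime (T : ℝ) : Continuous (clampTime T) := by
  unfold clampTime; fun_prop

lemma clampTime_mem {T : ℝ} (hT : 0 < T) (t : ℝ) : clampTime T t ∈ Set.Icc 0 T :=
  ⟨le_max_left _ _, max_le hT.le (min_le_right _ _)⟩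

lemma clampTime_of_mem {T t : ℝ} (ht : t ∈ Set.Icc 0 T) : clampTime T t = t := by
  rw [clampTime, min_eq_left ht.2, max_eq_right ht.1]

/-- The weight `exp (-β(t) E_s - μ(t) s)`, where `β(t) = β (1 - t / (2T))` and
`μ(t) = μ - t / T`. -/
def wgt {d : ℕ} (β μ T : ℝ) (s : ℕ) (t : ℝ) (Z : Phase d s) : ℝ :=
  exp (-(β * energy Z + μ * s) + clampTime T t / T * (s + β * energy Z / 2))

lemma wgt_pos {d : ℕ} (β μ T : ℝ) (s : ℕ) (t : ℝ) (Z : Phase d s) : 0 < wgt β μ T s t Z :=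
  exp_pos _

lemma wgt_eq {d : ℕ} (β μ T : ℝ) (s : ℕ) (t : ℝ) (Z : Phase d s) :
    wgt β μ T s t Z = exp (-((μ - clampTime T t / T) * s))
      * exp (-(β * (1 - clampTime T t / T / 2) * energy Z)) := by
  rw [wgt, ← Real.exp_add]
  congr 1
  ring

lemma clampTime_div_mem {T : ℝ} (hT : 0 < T) (t : ℝ) : clampTime T t / T ∈ Set.Icc (0 : ℝ) 1 :=
  ⟨div_nonneg (clampTime_mem hT t).1 hT.le, (div_le_one hT).2 (clampTime_mem hT t).2⟩

lemma wgt_le {d : ℕ} {β T : ℝ} (hβ : 0 < β) (hT : 0 < T) (μ : ℝ) (s : ℕ) (t : ℝ)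
    (Z : Phase d s) :
    wgt β μ T s t Z ≤ exp (-((μ - 1) * s)) * exp (-(β / 2 * energy Z)) := by
  rw [wgt, ← Real.exp_add]
  have h0 : 0 ≤ (s : ℝ) + β * energy Z / 2 := by
    have := energy_nonneg Z
    positivity
  refine Real.exp_le_exp.2 ?_
  nlinarith [mul_le_mul_of_nonneg_right (clampTime_div_mem hT t).2 h0]

lemma le_wgt {d : ℕ} {β T : ℝ} (hβ : 0 < β) (hT : 0 < T) (μ : ℝ) (s : ℕ) (t : ℝ)
    (Z : Phase d s) : exp (-(β * energy Z + μ * s)) ≤ wgt β μ T s t Z := by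
  have h0 : 0 ≤ (s : ℝ) + β * energy Z / 2 := by
    have := energy_nonneg Z
    positivity
  exact Real.exp_le_exp.2 (le_add_of_nonneg_right (mul_nonneg (clampTime_div_mem hT t).1 h0))

/-- Families of continuous functions bounded by `M` times the time-dependent weight. -/
structure IsAdmissible {d : ℕ} (β μ T M : ℝ) (f : (s : ℕ) → ℝ → Phase d s → ℝ) : Prop where
  cont : ∀ s, Continuous (Function.uncurry (f s))
  bound : ∀ s t Z, |f s t Z| ≤ M * wgt β μ T s t Z

namespace IsAdmissible

variable {d : ℕ} {β μ T M M' : ℝ} {f g : (s : ℕ) → ℝ → Phase d s → ℝ}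

lemma nonneg (hf : IsAdmissible β μ T M f) : 0 ≤ M :=
  nonneg_of_mul_nonneg_left ((abs_nonneg _).trans (hf.bound 0 0 (fun _ => 0))) (wgt_pos ..)

lemma gaussian_bound (hf : IsAdmissible β μ T M f) (hβ : 0 < β) (hT : 0 < T) (s : ℕ) (t : ℝ)
    (Z : Phase d s) :
    |f s t Z| ≤ M * exp (-((μ - 1) * s)) * exp (-(β / 2 * energy Z)) := by
  rw [mul_assoc]
  exact (hf.bound s t Z).trans (mul_le_mul_of_nonneg_left (wgt_le hβ hT μ s t Z) hf.nonneg)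

lemma sub (hf : IsAdmissible β μ T M f) (hg : IsAdmissible β μ T M' g) :
    IsAdmissible β μ T (M + M') fun s t Z => f s t Z - g s t Z where
  cont s := (hf.cont s).sub (hg.cont s)
  bound s t Z := by
    rw [add_mul]
    exact (abs_sub _ _).trans (add_le_add (hf.bound s t Z) (hg.bound s t Z))

lemma add (hf : IsAdmissible β μ T M f) (hg : IsAdmissible β μ T M' g) :
    IsAdmissible β μ T (M + M') fun s t Z => f s t Z + g s t Z where
  cont s := (hf.cont s).add (hg.cont s)
  bound s t Z := by
    rw [add_mul]
    exact (abs_add_le _ _).trans (add_le_add (hf.bound s t Z) (hg.bound s t Z))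

lemma continuous_coll (hf : IsAdmissible β μ T M f) (hβ : 0 < β) (hT : 0 < T) (ℓ : ℝ) (s : ℕ) :
    Continuous (Function.uncurry fun τ (Y : Phase d s) =>
      ℓ⁻¹ * BoltzCollOp d s (f (s + 1) τ) Y) :=
  continuous_const.mul (continuous_boltzCollOp (half_pos hβ) (hf.cont (s + 1))
    fun t Y => hf.gaussian_bound hβ hT (s + 1) t Y)

end IsAdmissible

/-- The Duhamel term of the mild form of the Boltzmann hierarchy on `[0, T]`. -/
def collDuhamel {d : ℕ} (ℓ T : ℝ) (f : (s : ℕ) → ℝ → Phase d s → ℝ) (s : ℕ) (t : ℝ)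
    (Z : Phase d s) : ℝ :=
  duhamel (fun τ Y => ℓ⁻¹ * BoltzCollOp d s (f (s + 1) τ) Y) (clampTime T t) Z

/-- The constant in the weighted bound for the collision operator. -/
def collConst (d : ℕ) (β : ℝ) : ℝ :=
  (sphMeas d).real Set.univ * (4 * π / (β / 2)) ^ ((d : ℝ) / 2) * (3 / 2 * (1 / √(β / 2)))

lemma collConst_nonneg (d : ℕ) {β : ℝ} (hβ : 0 < β) : 0 ≤ collConst d β := by
  have := Real.pi_pos
  unfold collConst
  positivity

lemma sum_inv_sqrt_add_norm_le {d s : ℕ} {B : ℝ} (hB : 0 < B) (Z : Phase d s) :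
    ∑ i, (1 / √B + ‖(Z i).2‖) ≤ 3 / 2 * (1 / √B) * (s + B * energy Z) := by
  have hsB : 0 < √B := Real.sqrt_pos.2 hB
  have h1 : ∀ i, 1 / √B + ‖(Z i).2‖ ≤ 1 / √B * (3 / 2 + B / 2 * ‖(Z i).2‖ ^ 2) := by
    intro i
    rw [one_div, inv_mul_eq_div, le_div_iff₀ hsB, add_mul, inv_mul_cancel₀ hsB.ne']
    nlinarith [sq_nonneg (√B * ‖(Z i).2‖ - 1), Real.sq_sqrt hB.le]
  refine (Finset.sum_le_sum fun i _ => h1 i).trans ?_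
  rw [← Finset.mul_sum, Finset.sum_add_distrib, ← Finset.mul_sum]
  simp only [Finset.sum_const, Finset.card_univ, Fintype.card_fin, nsmul_eq_mul]
  have h2 : B / 2 * ∑ i, ‖(Z i).2‖ ^ 2 = B * energy Z := by
    unfold energy; ring
  rw [h2, mul_comm (3 / 2 : ℝ) (1 / √B), mul_assoc]
  have h3 : 0 ≤ B * energy Z := mul_nonneg hB.le (energy_nonneg Z)
  gcongr
  linarith

lemma abs_boltzCollOp_le_wgt {d : ℕ} {β μ T M : ℝ} {f : (s : ℕ) → ℝ → Phase d s → ℝ}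
    (hβ : 0 < β) (hT : 0 < T) (hf : IsAdmissible β μ T M f) (s : ℕ) (t : ℝ) (Z : Phase d s) :
    |BoltzCollOp d s (f (s + 1) t) Z|
      ≤ M * collConst d β * exp (1 - μ) * ((s + β * energy Z / 2) * wgt β μ T s t Z) := by
  have hθ := clampTime_div_mem hT t
  have hM := hf.nonneg
  have hK := collConst_nonneg d hβ
  set θ := clampTime T t / T with hθdef
  have hb : β / 2 ≤ β * (1 - θ / 2) := by nlinarith [hθ.2]
  have h1 : ∀ Y, |f (s + 1) t Y|
      ≤ M * exp (-((μ - θ) * ((s + 1 : ℕ) : ℝ))) * exp (-(β * (1 - θ / 2) * energy Y)) := by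
    intro Y
    rw [mul_assoc, hθdef, ← wgt_eq]
    exact hf.bound (s + 1) t Y
  refine (abs_boltzCollOp_le (half_pos hβ) hb h1 Z).trans ?_
  have h2 := sum_inv_sqrt_add_norm_le (half_pos hβ) Z
  have h3 : exp (-((μ - θ) * ((s + 1 : ℕ) : ℝ))) ≤ exp (1 - μ) * exp (-((μ - θ) * s)) := by
    rw [← Real.exp_add]
    refine Real.exp_le_exp.2 ?_
    push_cast
    linarith [hθ.2]
  have h0 : 0 ≤ (s : ℝ) + β / 2 * energy Z := by
    have := energy_nonneg Z
    positivity
  calc M * exp (-((μ - θ) * ((s + 1 : ℕ) : ℝ))) * exp (-(β * (1 - θ / 2) * energy Z)) *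
        ((sphMeas d).real Set.univ * (4 * π / (β / 2)) ^ ((d : ℝ) / 2)) *
          ∑ i, (1 / √(β / 2) + ‖(Z i).2‖)
      ≤ M * (exp (1 - μ) * exp (-((μ - θ) * s))) * exp (-(β * (1 - θ / 2) * energy Z)) *
        ((sphMeas d).real Set.univ * (4 * π / (β / 2)) ^ ((d : ℝ) / 2)) *
          (3 / 2 * (1 / √(β / 2)) * (s + β / 2 * energy Z)) := by
        have := Real.pi_pos
        gcongr
    _ = M * collConst d β * exp (1 - μ) * ((s + β * energy Z / 2) * wgt β μ T s t Z) := by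
        rw [wgt_eq, ← hθdef, collConst]
        ring

lemma integral_mul_exp_le {A T t : ℝ} (hT : 0 < T) :
    ∫ τ in (0 : ℝ)..t, A * exp (τ / T * A) ≤ T * exp (t / T * A) := by
  have hderiv : ∀ τ ∈ Set.uIcc 0 t,
      HasDerivAt (fun τ => T * exp (τ / T * A)) (A * exp (τ / T * A)) τ := by
    intro τ _
    have h := ((((hasDerivAt_id τ).div_const T).mul_const A).exp).const_mul T
    convert! h using 1
    simp only [id]
    field_simp
  rw [intervalIntegral.integral_eq_sub_of_hasDerivAt hderiv
    ((by fun_prop : Continuous fun τ => A * exp (τ / T * A)).intervalIntegrable _ _)]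
  have : 0 ≤ T * exp (0 / T * A) := by positivity
  linarith

lemma IsAdmissible.continuous_collDuhamel {d : ℕ} {β μ T M : ℝ}
    {f : (s : ℕ) → ℝ → Phase d s → ℝ} (hf : IsAdmissible β μ T M f) (hβ : 0 < β) (hT : 0 < T)
    (ℓ : ℝ) (s : ℕ) : Continuous (Function.uncurry (collDuhamel ℓ T f s)) := by
  have hp : Continuous fun p : ℝ × Phase d s => (clampTime T p.1, p.2) :=
    ((continuous_clampTime T).comp continuous_fst).prodMk continuous_snd
  have h := (continuous_duhamel (hf.continuous_coll hβ hT ℓ s)).comp hp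
  simp only [Function.comp_def] at h
  exact h

lemma IsAdmissible.abs_collDuhamel_le {d : ℕ} {ℓ β μ T M : ℝ}
    {f : (s : ℕ) → ℝ → Phase d s → ℝ} (hf : IsAdmissible β μ T M f)
    (hℓ : 0 < ℓ) (hβ : 0 < β) (hT : 0 < T) (s : ℕ) (t : ℝ) (Z : Phase d s) :
    |collDuhamel ℓ T f s t Z|
      ≤ (ℓ⁻¹ * collConst d β * exp (1 - μ) * T) * (M * wgt β μ T s t Z) := by
  have ht := clampTime_mem hT t
  have hM := hf.nonneg
  have hK := collConst_nonneg d hβ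
  obtain ⟨A, hA⟩ : ∃ A : ℝ, A = s + β * energy Z / 2 := ⟨_, rfl⟩
  obtain ⟨c, hc⟩ : ∃ c : ℝ, c =
    ℓ⁻¹ * (M * collConst d β * exp (1 - μ) * exp (-(β * energy Z + μ * s))) := ⟨_, rfl⟩
  have hc0 : 0 ≤ c := by rw [hc]; positivity
  have h1 : ∀ τ ∈ Set.Ioc 0 (clampTime T t),
      ‖ℓ⁻¹ * BoltzCollOp d s (f (s + 1) τ) (shift (τ - clampTime T t) Z)‖
        ≤ c * (A * exp (τ / T * A)) := by
    intro τ hτ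
    have h2 := abs_boltzCollOp_le_wgt hβ hT hf s τ (shift (τ - clampTime T t) Z)
    rw [wgt, energy_shift, clampTime_of_mem (t := τ) ⟨hτ.1.le, hτ.2.trans ht.2⟩, Real.exp_add,
      ← hA] at h2
    rw [Real.norm_eq_abs, abs_mul, abs_of_pos (inv_pos.2 hℓ), hc]
    exact (mul_le_mul_of_nonneg_left h2 (inv_pos.2 hℓ).le).trans (le_of_eq (by ring))
  have hcont : Continuous fun τ => c * (A * exp (τ / T * A)) := by fun_prop
  have h3 := intervalIntegral.norm_integral_le_of_norm_le ht.1 (.of_forall h1)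
    (hcont.intervalIntegrable (μ := volume) _ _)
  rw [Real.norm_eq_abs] at h3
  have h4 : c * (T * exp (clampTime T t / T * A))
      = (ℓ⁻¹ * collConst d β * exp (1 - μ) * T) * (M * wgt β μ T s t Z) := by
    rw [wgt, Real.exp_add, hc, hA]
    ring
  rw [← h4]
  simp only [collDuhamel, duhamel]
  refine h3.trans ?_
  rw [intervalIntegral.integral_const_mul]
  exact mul_le_mul_of_nonneg_left (integral_mul_exp_le hT) hc0

/-- The Duhamel operator is a contraction for small times. -/
lemma isAdmissible_collDuhamel {d : ℕ} {ℓ β μ T M : ℝ} {f : (s : ℕ) → ℝ → Phase d s → ℝ}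
    (hℓ : 0 < ℓ) (hβ : 0 < β) (hT : 0 < T)
    (hsmall : ℓ⁻¹ * collConst d β * exp (1 - μ) * T ≤ 1 / 2) (hf : IsAdmissible β μ T M f) :
    IsAdmissible β μ T (1 / 2 * M) (collDuhamel ℓ T f) where
  cont := hf.continuous_collDuhamel hβ hT ℓ
  bound s t Z := by
    rw [mul_assoc]
    exact (hf.abs_collDuhamel_le hℓ hβ hT s t Z).trans
      (mul_le_mul_of_nonneg_right hsmall (mul_nonneg hf.nonneg (wgt_pos ..).le))

lemma collDuhamel_sub {d : ℕ} {ℓ β μ T M M' : ℝ} {f g : (s : ℕ) → ℝ → Phase d s → ℝ}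
    (hβ : 0 < β) (hT : 0 < T) (hf : IsAdmissible β μ T M f) (hg : IsAdmissible β μ T M' g)
    (s : ℕ) (t : ℝ) (Z : Phase d s) :
    collDuhamel ℓ T (fun s t Z => f s t Z - g s t Z) s t Z
      = collDuhamel ℓ T f s t Z - collDuhamel ℓ T g s t Z := by
  have hslice : ∀ {h : (s : ℕ) → ℝ → Phase d s → ℝ} {N : ℝ}, IsAdmissible β μ T N h → ∀ τ,
      Continuous (h (s + 1) τ) := fun hh τ =>
    (hh.cont (s + 1)).comp (continuous_const.prodMk continuous_id)
  have hintegrable : ∀ {h : (s : ℕ) → ℝ → Phase d s → ℝ} {N : ℝ}, IsAdmissible β μ T N h →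
      IntervalIntegrable (fun τ => ℓ⁻¹ * BoltzCollOp d s (h (s + 1) τ)
        (shift (τ - clampTime T t) Z)) volume 0 (clampTime T t) := fun hh => by
    have hp : Continuous fun τ : ℝ => (τ, shift (τ - clampTime T t) Z) :=
      continuous_id.prodMk (continuous_shift.comp
        ((continuous_id.sub continuous_const).prodMk continuous_const))
    exact ((hh.continuous_coll hβ hT ℓ s).comp hp).intervalIntegrable _ _
  simp only [collDuhamel, duhamel]
  rw [← intervalIntegral.integral_sub (hintegrable hf) (hintegrable hg)]
  refine intervalIntegral.integral_congr fun τ _ => ?_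
  rw [boltzCollOp_sub (half_pos hβ) (hslice hf τ) (hslice hg τ)
    (hf.gaussian_bound hβ hT (s + 1) τ) (hg.gaussian_bound hβ hT (s + 1) τ), mul_sub]

lemma collDuhamel_comp_perm {d : ℕ} {ℓ T : ℝ} {f : (s : ℕ) → ℝ → Phase d s → ℝ}
    (hf : ∀ s (σ : Equiv.Perm (Fin s)) t Z, f s t (Z ∘ σ) = f s t Z) (s : ℕ)
    (σ : Equiv.Perm (Fin s)) (t : ℝ) (Z : Phase d s) :
    collDuhamel ℓ T f s t (Z ∘ σ) = collDuhamel ℓ T f s t Z := by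
  simp only [collDuhamel, duhamel, shift_comp_perm]
  refine intervalIntegral.integral_congr fun τ _ => ?_
  rw [boltzCollOp_comp_perm fun σ Y => hf (s + 1) σ τ Y]

/-! ### Mild solutions of the hierarchy -/

/-- The mild form on `[0, T]` of the Boltzmann hierarchy with data `f₀`. -/
def IsMild {d : ℕ} (ℓ T : ℝ) (f₀ : (s : ℕ) → Phase d s → ℝ)
    (f : (s : ℕ) → ℝ → Phase d s → ℝ) : Prop :=
  ∀ s t Z, f s t Z = f₀ s (shift (-clampTime T t) Z) + collDuhamel ℓ T f s t Z

lemma isAdmissible_zero {d : ℕ} (β μ T : ℝ) :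
    IsAdmissible β μ T 0 fun (s : ℕ) (_ : ℝ) (_ : Phase d s) => (0 : ℝ) where
  cont _ := continuous_const
  bound s t Z := by simp

lemma isAdmissible_freeFlow {d : ℕ} {β μ T : ℝ} (hβ : 0 < β) (hT : 0 < T)
    {f₀ : (s : ℕ) → Phase d s → ℝ} (hc : ∀ s, Continuous (f₀ s))
    (hb : ∀ s Z, |f₀ s Z| ≤ exp (-(β * energy Z + μ * s))) :
    IsAdmissible β μ T 1 fun s t Z => f₀ s (shift (-clampTime T t) Z) where
  cont s := by
    have hp : Continuous fun p : ℝ × Phase d s => (-clampTime T p.1, p.2) :=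
      ((continuous_clampTime T).comp continuous_fst).neg.prodMk continuous_snd
    exact (hc s).comp (continuous_shift.comp hp)
  bound s t Z := by
    rw [one_mul]
    refine le_trans ?_ (le_wgt hβ hT μ s t Z)
    have h := hb s (shift (-clampTime T t) Z)
    rwa [energy_shift] at h

/-- The Picard iterates for the mild form of the Boltzmann hierarchy. -/
def picard {d : ℕ} (ℓ T : ℝ) (f₀ : (s : ℕ) → Phase d s → ℝ) :
    ℕ → (s : ℕ) → ℝ → Phase d s → ℝ
  | 0 => fun _ _ _ => 0
  | n + 1 => fun s t Z =>
      f₀ s (shift (-clampTime T t) Z) + collDuhamel ℓ T (picard ℓ T f₀ n) s t Z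

section Picard

variable {d : ℕ} {ℓ β μ T : ℝ} {f₀ : (s : ℕ) → Phase d s → ℝ}

lemma isAdmissible_picard (hℓ : 0 < ℓ) (hβ : 0 < β) (hT : 0 < T)
    (hsmall : ℓ⁻¹ * collConst d β * exp (1 - μ) * T ≤ 1 / 2) (hc : ∀ s, Continuous (f₀ s))
    (hb : ∀ s Z, |f₀ s Z| ≤ exp (-(β * energy Z + μ * s))) (n : ℕ) :
    IsAdmissible β μ T 2 (picard ℓ T f₀ n) := by
  induction n with
  | zero => exact ⟨fun _ => continuous_const, fun s t Z => by
      simpa [picard] using (wgt_pos β μ T s t Z).le⟩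
  | succ n ih =>
    have h := (isAdmissible_freeFlow hβ hT hc hb).add
      (isAdmissible_collDuhamel hℓ hβ hT hsmall ih)
    rwa [show (1 : ℝ) + 1 / 2 * 2 = 2 by norm_num] at h

lemma picard_comp_perm (hs : ∀ s (σ : Equiv.Perm (Fin s)) Z, f₀ s (Z ∘ σ) = f₀ s Z) (n : ℕ) :
    ∀ s (σ : Equiv.Perm (Fin s)) t Z, picard ℓ T f₀ n s t (Z ∘ σ) = picard ℓ T f₀ n s t Z := by
  induction n with
  | zero => intros; rfl
  | succ n ih =>
    intro s σ t Z
    simp only [picard]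
    rw [shift_comp_perm, hs, collDuhamel_comp_perm ih]

lemma isAdmissible_picard_succ_sub (hℓ : 0 < ℓ) (hβ : 0 < β) (hT : 0 < T)
    (hsmall : ℓ⁻¹ * collConst d β * exp (1 - μ) * T ≤ 1 / 2) (hc : ∀ s, Continuous (f₀ s))
    (hb : ∀ s Z, |f₀ s Z| ≤ exp (-(β * energy Z + μ * s))) (n : ℕ) :
    IsAdmissible β μ T ((1 / 2) ^ n)
      fun s t Z => picard ℓ T f₀ (n + 1) s t Z - picard ℓ T f₀ n s t Z := by
  induction n with
  | zero =>
    have h := ((isAdmissible_freeFlow hβ hT hc hb).add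
      (isAdmissible_collDuhamel hℓ hβ hT hsmall (isAdmissible_zero β μ T))).sub
        (isAdmissible_zero β μ T)
    rwa [show (1 : ℝ) + 1 / 2 * 0 + 0 = (1 / 2) ^ 0 by norm_num] at h
  | succ n ih =>
    have h := isAdmissible_collDuhamel hℓ hβ hT hsmall ih
    rw [← pow_succ'] at h
    refine ⟨fun s => ?_, fun s t Z => ?_⟩
    · exact ((isAdmissible_picard hℓ hβ hT hsmall hc hb (n + 1 + 1)).cont s).sub
        ((isAdmissible_picard hℓ hβ hT hsmall hc hb (n + 1)).cont s)
    · have h2 := h.bound s t Z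
      rw [collDuhamel_sub hβ hT (isAdmissible_picard hℓ hβ hT hsmall hc hb (n + 1))
        (isAdmissible_picard hℓ hβ hT hsmall hc hb n)] at h2
      have h3 : picard ℓ T f₀ (n + 1 + 1) s t Z - picard ℓ T f₀ (n + 1) s t Z
          = collDuhamel ℓ T (picard ℓ T f₀ (n + 1)) s t Z
            - collDuhamel ℓ T (picard ℓ T f₀ n) s t Z := by
        simp only [picard]
        ring
      rw [h3]
      exact h2

/-- Existence of mild solutions for small times. -/
lemma exists_isMild (hℓ : 0 < ℓ) (hβ : 0 < β) (hT : 0 < T)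
    (hsmall : ℓ⁻¹ * collConst d β * exp (1 - μ) * T ≤ 1 / 2) (hc : ∀ s, Continuous (f₀ s))
    (hs : ∀ s (σ : Equiv.Perm (Fin s)) Z, f₀ s (Z ∘ σ) = f₀ s Z)
    (hb : ∀ s Z, |f₀ s Z| ≤ exp (-(β * energy Z + μ * s))) :
    ∃ f, IsAdmissible β μ T 2 f ∧
      (∀ s (σ : Equiv.Perm (Fin s)) t Z, f s t (Z ∘ σ) = f s t Z) ∧ IsMild ℓ T f₀ f := by
  have hadm := isAdmissible_picard hℓ hβ hT hsmall hc hb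
  have hstep : ∀ s t Z n, dist (picard ℓ T f₀ n s t Z) (picard ℓ T f₀ (n + 1) s t Z)
      ≤ wgt β μ T s t Z * (1 / 2) ^ n := by
    intro s t Z n
    rw [dist_comm, Real.dist_eq, mul_comm]
    exact (isAdmissible_picard_succ_sub hℓ hβ hT hsmall hc hb n).bound s t Z
  have hlim : ∀ s t Z, ∃ a, Filter.Tendsto (fun n => picard ℓ T f₀ n s t Z) Filter.atTop
      (nhds a) := fun s t Z =>
    cauchySeq_tendsto_of_complete (cauchySeq_of_le_geometric _ _ (by norm_num) (hstep s t Z))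
  choose f hf using hlim
  have hdist : ∀ n s t Z, |f s t Z - picard ℓ T f₀ n s t Z|
      ≤ 2 * (1 / 2) ^ n * wgt β μ T s t Z := by
    intro n s t Z
    have h := dist_le_of_le_geometric_of_tendsto _ _ (by norm_num) (hstep s t Z) (hf s t Z) n
    rw [dist_comm, Real.dist_eq] at h
    refine h.trans (le_of_eq ?_)
    ring
  have hgeom : Filter.Tendsto (fun n : ℕ => (1 / 2 : ℝ) ^ n) Filter.atTop (nhds 0) :=
    tendsto_pow_atTop_nhds_zero_of_lt_one (by norm_num) (by norm_num)
  have hcont : ∀ s, Continuous (Function.uncurry (f s)) := by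
    intro s
    have hunif : TendstoUniformly (fun n => Function.uncurry (picard ℓ T f₀ n s))
        (Function.uncurry (f s)) Filter.atTop := by
      rw [Metric.tendstoUniformly_iff]
      intro ε hε
      have h0 : Filter.Tendsto (fun n : ℕ => 2 * (1 / 2 : ℝ) ^ n * exp (-((μ - 1) * s)))
          Filter.atTop (nhds 0) := by
        simpa using (hgeom.const_mul 2).mul_const (exp (-((μ - 1) * s)))
      filter_upwards [h0.eventually (gt_mem_nhds hε)] with n hn p
      refine lt_of_le_of_lt ?_ hn
      rw [Real.dist_eq]
      refine (hdist n s p.1 p.2).trans (mul_le_mul_of_nonneg_left ?_ (by positivity))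
      refine (wgt_le hβ hT μ s p.1 p.2).trans (mul_le_of_le_one_right (exp_pos _).le ?_)
      have := energy_nonneg p.2
      exact Real.exp_le_one_iff.2 (neg_nonpos.2 (by positivity))
    exact hunif.continuous (Filter.Frequently.of_forall fun n => (hadm n).cont s)
  have hfadm : IsAdmissible β μ T 2 f := ⟨hcont, fun s t Z =>
    le_of_tendsto (hf s t Z).abs (.of_forall fun n => (hadm n).bound s t Z)⟩
  refine ⟨f, hfadm, fun s σ t Z => ?_, fun s t Z => ?_⟩
  · refine tendsto_nhds_unique (hf s t (Z ∘ σ)) ?_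
    simpa only [picard_comp_perm hs] using hf s t Z
  · have hD : Filter.Tendsto (fun n => collDuhamel ℓ T (picard ℓ T f₀ n) s t Z) Filter.atTop
        (nhds (collDuhamel ℓ T f s t Z)) := by
      rw [tendsto_iff_dist_tendsto_zero]
      refine squeeze_zero (g := fun n => 1 / 2 * (2 * (1 / 2) ^ n) * wgt β μ T s t Z)
        (fun _ => dist_nonneg) (fun n => ?_) ?_
      · have h1 : IsAdmissible β μ T (2 * (1 / 2) ^ n)
            fun s t Z => f s t Z - picard ℓ T f₀ n s t Z :=
          ⟨fun s => (hcont s).sub ((hadm n).cont s), hdist n⟩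
        have h2 := (isAdmissible_collDuhamel hℓ hβ hT hsmall h1).bound s t Z
        rw [collDuhamel_sub hβ hT hfadm (hadm n)] at h2
        rw [dist_comm, Real.dist_eq]
        exact h2
      · have h := ((hgeom.const_mul 2).const_mul (1 / 2)).mul_const (wgt β μ T s t Z)
        rwa [mul_zero, mul_zero, zero_mul] at h
    refine tendsto_nhds_unique ((hf s t Z).comp (Filter.tendsto_add_atTop_nat 1)) ?_
    exact hD.const_add (f₀ s (shift (-clampTime T t) Z))

/-- Uniqueness of admissible mild solutions for small times. -/
lemma IsMild.eq_of_isAdmissible {M M' : ℝ} {f g : (s : ℕ) → ℝ → Phase d s → ℝ}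
    (hf : IsMild ℓ T f₀ f) (hg : IsMild ℓ T f₀ g) (hℓ : 0 < ℓ) (hβ : 0 < β) (hT : 0 < T)
    (hsmall : ℓ⁻¹ * collConst d β * exp (1 - μ) * T ≤ 1 / 2)
    (hfa : IsAdmissible β μ T M f) (hga : IsAdmissible β μ T M' g)
    (s : ℕ) (t : ℝ) (Z : Phase d s) : f s t Z = g s t Z := by
  have hfix : (fun s t Z => f s t Z - g s t Z)
      = collDuhamel ℓ T fun s t Z => f s t Z - g s t Z := by
    funext s t Z
    rw [collDuhamel_sub hβ hT hfa hga, hf s t Z, hg s t Z]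
    ring
  have hadm : ∀ n : ℕ, IsAdmissible β μ T ((1 / 2) ^ n * (M + M'))
      fun s t Z => f s t Z - g s t Z := by
    intro n
    induction n with
    | zero => simpa using hfa.sub hga
    | succ n ih =>
      have h := isAdmissible_collDuhamel hℓ hβ hT hsmall ih
      rwa [← mul_assoc, ← pow_succ', ← hfix] at h
  have hgeom : Filter.Tendsto (fun n : ℕ => (1 / 2 : ℝ) ^ n * (M + M') * wgt β μ T s t Z)
      Filter.atTop (nhds 0) := by
    simpa using ((tendsto_pow_atTop_nhds_zero_of_lt_one (r := (1 / 2 : ℝ)) (by norm_num)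
      (by norm_num)).mul_const (M + M')).mul_const (wgt β μ T s t Z)
  have h := ge_of_tendsto' hgeom fun n => (hadm n).bound s t Z
  exact sub_eq_zero.1 (abs_nonpos_iff.1 h)

end Picard

lemma IsMild.solves {d : ℕ} {ℓ β μ T M : ℝ} {f₀ : (s : ℕ) → Phase d s → ℝ}
    {f : (s : ℕ) → ℝ → Phase d s → ℝ} (hf : IsMild ℓ T f₀ f) (hβ : 0 < β) (hT : 0 < T)
    (hc : ∀ s, Continuous (f₀ s)) (hfa : IsAdmissible β μ T M f) :
    SolvesBoltzmannHierarchy d ℓ (Set.Ioo 0 T) f := by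
  intro s _ φ hφ hφc hφ0
  refine Eq.trans ?_ (integral_transport_duhamel hT (hfa.continuous_coll hβ hT ℓ s) (hc s) hφ hφc hφ0)
  refine setIntegral_congr_fun measurableSet_Ioo fun t ht => ?_
  refine integral_congr_ae (.of_forall fun Z => ?_)
  have h := hf s t Z
  simp only [collDuhamel, clampTime_of_mem (Set.Ioo_subset_Icc_self ht)] at h
  simp only [← h]
  ring

lemma SolvesBoltzmannHierarchy.mild {d : ℕ} {ℓ β μ T M : ℝ}
    {f : (s : ℕ) → ℝ → Phase d s → ℝ} (hf : SolvesBoltzmannHierarchy d ℓ (Set.Ioo 0 T) f)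
    (hβ : 0 < β) (hT : 0 < T) (hfa : IsAdmissible β μ T M f) {s : ℕ} (hs : 1 ≤ s) (t : ℝ)
    (Z : Phase d s) :
    f s (clampTime T t) Z = f s 0 (shift (-clampTime T t) Z) + collDuhamel ℓ T f s t Z := by
  refine mild_of_weak hT (hfa.cont s) (hfa.continuous_coll hβ hT ℓ s)
    (fun φ hφ hφc hφ0 => ?_) (clampTime_mem hT t) Z
  refine Eq.trans ?_ (hf s hs φ hφ hφc hφ0)
  refine setIntegral_congr_fun measurableSet_Ioo fun t ht => ?_
  refine integral_congr_ae (.of_forall fun Z => ?_)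
  simp only
  ring

lemma collDuhamel_zero {d : ℕ} (ℓ T : ℝ) (f : (s : ℕ) → ℝ → Phase d s → ℝ) (t : ℝ)
    (Z : Phase d 0) : collDuhamel ℓ T f 0 t Z = 0 := by
  simp [collDuhamel, duhamel, BoltzCollOp]

/-! ### The smallness condition -/

/-- The dimensional constant in the bound for the collision operator. -/
def dimConst (d : ℕ) : ℝ :=
  ((sphMeas d).real Set.univ + 1) * (8 * π) ^ ((d : ℝ) / 2) * (3 / 2 * √2)

lemma dimConst_pos (d : ℕ) : 0 < dimConst d := by
  have := Real.pi_pos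
  unfold dimConst
  positivity

lemma collConst_mul_rpow_le (d : ℕ) {β : ℝ} (hβ : 0 < β) :
    collConst d β * β ^ (((d : ℝ) + 1) / 2) ≤ dimConst d := by
  have hπ := Real.pi_pos
  have hsβ : 0 < √β := Real.sqrt_pos.2 hβ
  have h1 : β ^ (((d : ℝ) + 1) / 2) = β ^ ((d : ℝ) / 2) * √β := by
    rw [add_div, Real.rpow_add hβ, Real.sqrt_eq_rpow]
  have h2 : (4 * π / (β / 2)) ^ ((d : ℝ) / 2) * β ^ ((d : ℝ) / 2) = (8 * π) ^ ((d : ℝ) / 2) := by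
    rw [← Real.mul_rpow (by positivity) hβ.le]
    congr 1
    field_simp
    ring
  have h3 : 1 / √(β / 2) * √β = √2 := by
    rw [Real.sqrt_div hβ.le]
    field_simp
  calc collConst d β * β ^ (((d : ℝ) + 1) / 2)
      = (sphMeas d).real Set.univ * ((4 * π / (β / 2)) ^ ((d : ℝ) / 2) * β ^ ((d : ℝ) / 2))
          * (3 / 2 * (1 / √(β / 2) * √β)) := by rw [h1, collConst]; ring
    _ = (sphMeas d).real Set.univ * (8 * π) ^ ((d : ℝ) / 2) * (3 / 2 * √2) := by rw [h2, h3]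
    _ ≤ dimConst d := by
        unfold dimConst
        gcongr
        linarith

lemma small_of_lt {d : ℕ} {ℓ β μ T : ℝ} (hℓ : 0 < ℓ) (hβ : 0 < β)
    (hT : 2 * dimConst d * T ≤ ℓ * exp (μ - 1) * β ^ (((d : ℝ) + 1) / 2)) (hT0 : 0 < T) :
    ℓ⁻¹ * collConst d β * exp (1 - μ) * T ≤ 1 / 2 := by
  have hp : 0 < β ^ (((d : ℝ) + 1) / 2) := Real.rpow_pos_of_pos hβ _
  have h1 := mul_le_mul_of_nonneg_right (collConst_mul_rpow_le d hβ) hT0.le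
  have h2 : 2 * (collConst d β * T) ≤ ℓ * exp (μ - 1) := by
    refine le_of_mul_le_mul_right ?_ hp
    linarith
  have h3 : ℓ⁻¹ * collConst d β * exp (1 - μ) * T
      = collConst d β * T / (ℓ * exp (μ - 1)) := by
    rw [show 1 - μ = -(μ - 1) by ring, Real.exp_neg]
    field_simp
  rw [h3, div_le_iff₀ (by positivity)]
  linarith

/-- The constant in the bound for the existence time. -/
def timeConst (d : ℕ) : ℝ := (2 * dimConst d * exp 2 * 2 ^ (((d : ℝ) + 1) / 2))⁻¹

lemma timeConst_pos (d : ℕ) : 0 < timeConst d := by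
  have := dimConst_pos d
  unfold timeConst
  positivity

lemma small_half_of_lt_timeConst {d : ℕ} {ℓ β μ T : ℝ} (hℓ : 0 < ℓ) (hβ : 0 < β) (hT0 : 0 < T)
    (hT : T < timeConst d * ℓ * exp μ * β ^ (((d : ℝ) + 1) / 2)) :
    ℓ⁻¹ * collConst d (β / 2) * exp (1 - (μ - 1)) * T ≤ 1 / 2 := by
  refine small_of_lt hℓ (half_pos hβ) ?_ hT0
  have hK := dimConst_pos d
  have h2 : (0 : ℝ) < 2 ^ (((d : ℝ) + 1) / 2) := by positivity
  rw [Real.div_rpow hβ.le (by norm_num), show μ - 1 - 1 = μ - 2 by ring, Real.exp_sub]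
  refine (mul_le_mul_of_nonneg_left hT.le (by positivity)).trans (le_of_eq ?_)
  unfold timeConst
  field_simp

lemma small_of_lt_timeConst {d : ℕ} {ℓ β μ T : ℝ} (hℓ : 0 < ℓ) (hβ : 0 < β) (hT0 : 0 < T)
    (hT : T < timeConst d * ℓ * exp μ * β ^ (((d : ℝ) + 1) / 2)) :
    ℓ⁻¹ * collConst d β * exp (1 - μ) * T ≤ 1 / 2 := by
  refine small_of_lt hℓ hβ ?_ hT0
  have hK := dimConst_pos d
  have hp : 0 < β ^ (((d : ℝ) + 1) / 2) := Real.rpow_pos_of_pos hβ _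
  have h2 : (1 : ℝ) ≤ 2 ^ (((d : ℝ) + 1) / 2) := Real.one_le_rpow (by norm_num) (by positivity)
  have h3 : 2 * dimConst d * (timeConst d * ℓ * exp μ * β ^ (((d : ℝ) + 1) / 2))
      = ℓ * exp (μ - 2) * β ^ (((d : ℝ) + 1) / 2) / 2 ^ (((d : ℝ) + 1) / 2) := by
    rw [Real.exp_sub]
    unfold timeConst
    field_simp
  refine (mul_le_mul_of_nonneg_left hT.le (by positivity)).trans ?_
  rw [h3]
  refine (div_le_self (by positivity) h2).trans ?_
  gcongr
  norm_num

/-! ### Well-posedness -/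

lemma abs_le_of_weighted_le {a x y M : ℝ} (h : |a| * exp x * exp y ≤ M) :
    |a| ≤ M * exp (-(x + y)) := by
  rw [Real.exp_neg, ← div_eq_mul_inv, le_div_iff₀ (exp_pos _), Real.exp_add, ← mul_assoc]
  exact h

/-- The extension by constants in time of a solution of the hierarchy is a mild solution. -/
lemma GoodLocalSolE.exists_isMild {d : ℕ} {ℓ T β₀ μ₀ : ℝ} {f₀ : (s : ℕ) → Phase d s → ℝ}
    {g : (s : ℕ) → ℝ → Phase d s → ℝ} (hg : GoodLocalSolE d ℓ T β₀ μ₀ f₀ g) (hβ : 0 < β₀)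
    (hT : 0 < T) :
    ∃ G : (s : ℕ) → ℝ → Phase d s → ℝ, IsAdmissible (β₀ / 2) (μ₀ - 1) T 2 G ∧
      IsMild ℓ T (fun s Z => if s = 0 then 0 else f₀ s Z) G ∧
      ∀ s, 1 ≤ s → ∀ t ∈ Set.Icc 0 T, ∀ Z, G s t Z = g s t Z := by
  obtain ⟨hcont, -, hinit, hbound, hsol⟩ := hg
  let G : (s : ℕ) → ℝ → Phase d s → ℝ := fun s t Z => if s = 0 then 0 else g s (clampTime T t) Z
  have hGg : ∀ s, 1 ≤ s → ∀ t ∈ Set.Icc 0 T, ∀ Z, G s t Z = g s t Z := by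
    intro s hs t ht Z
    simp only [G, if_neg (Nat.one_le_iff_ne_zero.1 hs), clampTime_of_mem ht]
  have hGa : IsAdmissible (β₀ / 2) (μ₀ - 1) T 2 G := by
    refine ⟨fun s => ?_, fun s t Z => ?_⟩
    · by_cases hs : s = 0
      · have h0 : Function.uncurry (G s) = fun _ => 0 := by
          funext p
          simp [G, Function.uncurry, hs]
        rw [h0]
        exact continuous_const
      · have h0 : Function.uncurry (G s)
            = Function.uncurry (g s) ∘ fun p => (clampTime T p.1, p.2) := by
          funext p
          simp [G, Function.uncurry, hs]
        rw [h0]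
        exact (hcont s).comp_continuous
          (((continuous_clampTime T).comp continuous_fst).prodMk continuous_snd)
          fun p => ⟨clampTime_mem hT p.1, Set.mem_univ _⟩
    · by_cases hs : s = 0
      · simp only [G, if_pos hs, abs_zero]
        exact mul_nonneg zero_le_two (wgt_pos ..).le
      · simp only [G, if_neg hs]
        refine (abs_le_of_weighted_le (hbound _ (clampTime_mem hT t) s
          (Nat.one_le_iff_ne_zero.2 hs) Z)).trans ?_
        refine mul_le_mul_of_nonneg_left ?_ zero_le_two
        rw [one_div_mul_eq_div]
        exact le_wgt (half_pos hβ) hT (μ₀ - 1) s t Z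
  have hGs : SolvesBoltzmannHierarchy d ℓ (Set.Ioo 0 T) G := by
    intro s hs φ hφ hφc hφ0
    refine Eq.trans ?_ (hsol s hs φ hφ hφc hφ0)
    refine setIntegral_congr_fun measurableSet_Ioo fun t ht => ?_
    have ht' := Set.Ioo_subset_Icc_self ht
    have h1 : G (s + 1) t = g (s + 1) t := funext fun Z => hGg (s + 1) (Nat.le_add_left 1 s) t ht' Z
    simp only [h1, hGg s hs t ht']
  refine ⟨G, hGa, fun s t Z => ?_, hGg⟩
  by_cases hs : s = 0
  · subst hs
    simp [G, collDuhamel_zero]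
  · have hs1 : 1 ≤ s := Nat.one_le_iff_ne_zero.2 hs
    have h := hGs.mild (half_pos hβ) hT hGa hs1 t Z
    rw [hGg s hs1 _ (clampTime_mem hT t), hGg s hs1 0 ⟨le_rfl, hT.le⟩, hinit] at h
    simp only [if_neg hs]
    rw [← h]
    simp only [G, if_neg hs]

/-- **Local well-posedness of the Boltzmann hierarchy with velocity weights
(Theorem 11.3).** There is `C_d > 0`, depending only on `d`, such that: for continuous
symmetric data with `|f_∞^{(s)}(0)| e^{β₀ E_s} e^{μ₀ s} ≤ 1` and any
`T_L < C_d ℓ e^{μ₀} β₀^{(d+1)/2}`, there is a unique continuous symmetric solution of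
the Boltzmann hierarchy on `[0,T_L]` attaining the data and satisfying
`|f_∞^{(s)}(t)| e^{(1/2)β₀ E_s} e^{(μ₀−1)s} ≤ 2`. -/
theorem boltzmann_hierarchy_local_wellposedness_velocity_weights
    (d : ℕ) (hd : 2 ≤ d) :
    ∃ C : ℝ, 0 < C ∧
      ∀ (ℓ β₀ μ₀ : ℝ) (f₀ : (s : ℕ) → Phase d s → ℝ),
        0 < ℓ → 0 < β₀ →
        (∀ s : ℕ, Continuous (f₀ s)) →
        (∀ s : ℕ, ∀ σ : Equiv.Perm (Fin s), ∀ Z : Phase d s, f₀ s (Z ∘ σ) = f₀ s Z) →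
        (∀ s : ℕ, 1 ≤ s → ∀ Z : Phase d s,
          |f₀ s Z| * exp (β₀ * energy Z) * exp (μ₀ * s) ≤ 1) →
        ∀ T : ℝ, 0 < T → T < C * ℓ * exp μ₀ * β₀ ^ (((d : ℝ) + 1) / 2) →
        ∃ f : (s : ℕ) → ℝ → Phase d s → ℝ,
          GoodLocalSolE d ℓ T β₀ μ₀ f₀ f ∧
          ∀ g : (s : ℕ) → ℝ → Phase d s → ℝ,
            GoodLocalSolE d ℓ T β₀ μ₀ f₀ g →
            ∀ s : ℕ, 1 ≤ s → ∀ t ∈ Set.Icc (0 : ℝ) T, ∀ Z : Phase d s,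
              g s t Z = f s t Z := by
  refine ⟨timeConst d, timeConst_pos d, ?_⟩
  intro ℓ β₀ μ₀ f₀ hℓ hβ hc hsym hb T hT0 hT
  have hc' : ∀ s, Continuous fun Z : Phase d s => if s = 0 then 0 else f₀ s Z := by
    intro s
    by_cases h0 : s = 0
    · simpa only [if_pos h0] using continuous_const
    · simpa only [if_neg h0] using hc s
  obtain ⟨h, ha, hs, hm⟩ := exists_isMild (f₀ := fun s Z => if s = 0 then 0 else f₀ s Z) (μ := μ₀)
    hℓ hβ hT0 (small_of_lt_timeConst hℓ hβ hT0 hT)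
    hc'
    (fun s σ Z => by simp only [hsym])
    (fun s Z => by
      by_cases h0 : s = 0
      · simpa only [if_pos h0, abs_zero] using (exp_pos _).le
      · simpa only [if_neg h0, one_mul] using
          abs_le_of_weighted_le (hb s (Nat.one_le_iff_ne_zero.2 h0) Z))
  have hcut : ∀ s, 1 ≤ s → ∀ t Z, (if s = 0 then f₀ s Z else h s t Z) = h s t Z :=
    fun s h1 t Z => if_neg (Nat.one_le_iff_ne_zero.1 h1)
  have hwgt : ∀ s t Z, |h s t Z| ≤ 2 * exp (-(β₀ / 2 * energy Z + (μ₀ - 1) * s)) := by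
    intro s t Z
    rw [neg_add, add_comm, Real.exp_add, ← mul_assoc]
    exact ha.gaussian_bound hβ hT0 s t Z
  refine ⟨fun s t Z => if s = 0 then f₀ s Z else h s t Z, ⟨fun s => ?_, fun s σ t Z => ?_,
    fun s Z => ?_, fun t ht s h1 Z => ?_, ?_⟩, ?_⟩
  · refine Continuous.continuousOn ?_
    by_cases h0 : s = 0
    · simp only [if_pos h0]
      exact (hc s).comp continuous_snd
    · simp only [if_neg h0]
      exact ha.cont s
  · simp only [hs, hsym]
  · by_cases h0 : s = 0
    · simp only [if_pos h0]
    · simp only [if_neg h0]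
      have hD : collDuhamel ℓ T h s 0 Z = 0 := by
        simp [collDuhamel, duhamel, clampTime_of_mem (Set.left_mem_Icc.2 hT0.le)]
      rw [hm s 0 Z, hD, clampTime_of_mem (Set.left_mem_Icc.2 hT0.le), neg_zero, shift_zero,
        add_zero]
      exact if_neg h0
  · simp only [hcut s h1]
    rw [mul_assoc, ← Real.exp_add, ← le_div_iff₀ (exp_pos _), div_eq_mul_inv, ← Real.exp_neg,
      one_div_mul_eq_div]
    exact hwgt s t Z
  · intro s h1 φ hφ hφc hφ0
    simp only [hcut s h1, hcut (s + 1) (Nat.le_add_left 1 s)]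
    exact hm.solves hβ hT0 hc' ha s h1 φ hφ hφc hφ0
  · intro g hg s h1 t ht Z
    obtain ⟨G, hGa, hGm, hGg⟩ := hg.exists_isMild hβ hT0
    have hha : IsAdmissible (β₀ / 2) (μ₀ - 1) T 2 h := ⟨ha.cont, fun s t Z =>
      (hwgt s t Z).trans (mul_le_mul_of_nonneg_left
        (le_wgt (half_pos hβ) hT0 (μ₀ - 1) s t Z) zero_le_two)⟩
    simp only [hcut s h1]
    rw [← hGg s h1 t ht Z]
    exact hGm.eq_of_isAdmissible hm hℓ (half_pos hβ) hT0
      (small_half_of_lt_timeConst hℓ hβ hT0 hT) hGa hha s t Z
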